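/- arXiv:2311.15666 — 2 statements merged into one kernel-verified Lean document; each statement's English description precedes it below -/
import Mathlib

section
/- ∫_0^∞ x^11/(cos x − cosh x)^3 dx = −4455Γ^16/(2^15 π^4) − 935Γ^24/(2^20 π^8) + 297Γ^24/(2^18 π^7) − 189Γ^24/(2^20 π^6) − 195Γ^32/(2^27 π^12), where Γ = Γ(1/4). -/
open Real

section IntegralAsLatticeSum

open Filter Topology MeasureTheory Set
open scoped Nat Real
open Complex (I)

theorem integrableOn_pow_mul_exp_neg_mul (n : ℕ) {l : ℂ} (hl : 0 < l.re) :
    IntegrableOn (fun x : ℝ ↦ (x : ℂ) ^ n * Complex.exp (-(l * x))) (Ioi 0) := by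
  have hn : (0 : ℝ) < ↑n + 1 := by positivity
  have key := Real.integral_rpow_mul_exp_neg_mul_Ioi hn hl
  have hreal : IntegrableOn (fun x ↦ x ^ ((↑n + 1 : ℝ) - 1) * Real.exp (-(l.re * x))) (Ioi 0) :=
    .of_integral_ne_zero (by rw [key]; positivity)
  refine Integrable.mono' hreal (by fun_prop) ?_
  filter_upwards [ae_restrict_mem measurableSet_Ioi] with x hx
  simp [Complex.norm_exp, abs_of_pos (mem_Ioi.1 hx)]

theorem integral_pow_mul_exp_neg_mul_norm (n : ℕ) {l : ℂ} (hl : 0 < l.re) :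
    ∫ x in Ioi (0 : ℝ), ‖(x : ℂ) ^ n * Complex.exp (-(l * x))‖ = n ! / l.re ^ (n + 1) := by
  have hn : (0 : ℝ) < ↑n + 1 := by positivity
  have key := Real.integral_rpow_mul_exp_neg_mul_Ioi hn hl
  rw [Real.Gamma_nat_eq_factorial, ← Nat.cast_add_one, Real.rpow_natCast, one_div, inv_pow] at key
  rw [div_eq_inv_mul, ← key]
  refine setIntegral_congr_fun measurableSet_Ioi fun x hx ↦ ?_
  simp [Complex.norm_exp, abs_of_pos (mem_Ioi.1 hx)]

theorem tendsto_pow_mul_exp_neg_mul_atTop (n : ℕ) {l : ℂ} (hl : 0 < l.re) :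
    Tendsto (fun x : ℝ ↦ (x : ℂ) ^ n * Complex.exp (-(l * x))) atTop (𝓝 0) := by
  rw [tendsto_zero_iff_norm_tendsto_zero]
  have h := tendsto_rpow_mul_exp_neg_mul_atTop_nhds_zero n l.re hl
  refine h.congr' ?_
  filter_upwards [eventually_ge_atTop 0] with x hx
  simp [Complex.norm_exp, abs_of_nonneg hx]

theorem integral_pow_mul_exp_neg_mul (n : ℕ) {l : ℂ} (hl : 0 < l.re) :
    ∫ x in Ioi (0 : ℝ), (x : ℂ) ^ n * Complex.exp (-(l * x)) = n ! / l ^ (n + 1) := by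
  have hl0 : l ≠ 0 := by rintro rfl; simp at hl
  have hd (x : ℝ) : HasDerivAt (fun x : ℝ ↦ Complex.exp (-(l * x)))
      (-l * Complex.exp (-(l * x))) x := by
    have h := ((hasDerivAt_id (x : ℂ)).const_mul (-l)).cexp.comp_ofReal
    simpa [mul_comm] using h
  induction n with
  | zero =>
    have h := integral_Ioi_of_hasDerivAt_of_tendsto' (a := 0)
      (f := fun x : ℝ ↦ -l⁻¹ * Complex.exp (-(l * x)))
      (f' := fun x : ℝ ↦ (x : ℂ) ^ 0 * Complex.exp (-(l * x))) (m := 0)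
      (fun x _ ↦ by
        convert! (hd x).const_mul (-l⁻¹) using 1
        field_simp)
      (integrableOn_pow_mul_exp_neg_mul 0 hl)
      (by simpa using (tendsto_pow_mul_exp_neg_mul_atTop 0 hl).const_mul (-l⁻¹))
    rw [h]
    simp
  | succ n ih =>
    have hi := integrableOn_pow_mul_exp_neg_mul n hl
    have hi' := integrableOn_pow_mul_exp_neg_mul (n + 1) hl
    have h := integral_Ioi_of_hasDerivAt_of_tendsto' (a := 0)
      (f := fun x : ℝ ↦ -l⁻¹ * ((x : ℂ) ^ (n + 1) * Complex.exp (-(l * x))))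
      (f' := fun x : ℝ ↦ (x : ℂ) ^ (n + 1) * Complex.exp (-(l * x)) -
        (n + 1) / l * ((x : ℂ) ^ n * Complex.exp (-(l * x)))) (m := 0)
      (fun x _ ↦ by
        have hx := (hasDerivAt_pow (n + 1) (x : ℂ)).comp_ofReal
        convert! (hx.mul (hd x)).const_mul (-l⁻¹) using 1
        push_cast
        field_simp
        ring)
      (hi'.sub (hi.const_mul _))
      (by simpa using (tendsto_pow_mul_exp_neg_mul_atTop (n + 1) hl).const_mul (-l⁻¹))
    rw [integral_sub hi' (hi.const_mul _), integral_const_mul, ih] at h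
    simp only [Complex.ofReal_zero, ne_eq, Nat.add_eq_zero_iff, one_ne_zero, and_false,
      not_false_eq_true, zero_pow, zero_mul, mul_zero, sub_zero] at h
    rw [sub_eq_zero.1 h, Nat.factorial_succ]
    push_cast
    field_simp
    ring

theorem hasSum_choose_two_mul_pow {w : ℂ} (hw : ‖w‖ < 1) :
    HasSum (fun j : ℕ ↦ ((j + 1).choose 2 : ℂ) * w ^ j) (w / (1 - w) ^ 3) := by
  have h := (hasSum_choose_mul_geometric_of_norm_lt_one 2 hw).mul_left w
  rw [← hasSum_nat_add_iff' 1]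
  convert! h using 1
  · ext j; ring
  · simp [div_eq_mul_inv]

theorem hasSum_choose_two_mul_pow_prod {v w : ℂ} (hv : ‖v‖ < 1) (hw : ‖w‖ < 1) :
    HasSum (fun p : ℕ × ℕ ↦ (((p.1 + 1).choose 2 : ℂ) * v ^ p.1) *
      (((p.2 + 1).choose 2 : ℂ) * w ^ p.2)) (v / (1 - v) ^ 3 * (w / (1 - w) ^ 3)) := by
  have h := hasSum_choose_two_mul_pow hv
  have h' := hasSum_choose_two_mul_pow hw
  have hs := summable_mul_of_summable_norm h.summable.norm h'.summable.norm
  rw [← h.tsum_eq, ← h'.tsum_eq, tsum_mul_tsum_of_summable_norm h.summable.norm h'.summable.norm]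
  exact hs.hasSum

theorem hasSum_inv_cos_sub_cosh_cubed {x : ℝ} (hx : 0 < x) :
    HasSum (fun p : ℕ × ℕ ↦ -8 * (((p.1 + 1).choose 2 : ℂ) * ((p.2 + 1).choose 2 : ℂ)) *
      Complex.exp (-((p.1 + p.2 + 1 - I * (p.2 - p.1)) * x)))
      (1 / (Complex.cos x - Complex.cosh x) ^ 3) := by
  set w := Complex.exp (-x + I * x) with hw
  set v := Complex.exp (-x - I * x) with hv
  have hwn : ‖w‖ < 1 := by simp [hw, Complex.norm_exp, hx]
  have hvn : ‖v‖ < 1 := by simp [hv, Complex.norm_exp, hx]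
  have h := (hasSum_choose_two_mul_pow_prod hvn hwn).mul_left (-8 * Complex.exp (-x))
  convert! h using 1
  · ext p
    have e1 : Complex.exp (-((p.1 + p.2 + 1 - I * (p.2 - p.1)) * x)) =
        Complex.exp (-x) * v ^ p.1 * w ^ p.2 := by
      rw [hv, hw, ← Complex.exp_nat_mul, ← Complex.exp_nat_mul, ← Complex.exp_add,
        ← Complex.exp_add]
      congr 1
      ring
    rw [e1]
    ring
  · have e2 : Complex.cos x - Complex.cosh x = -(Complex.exp x / 2) * ((1 - v) * (1 - w)) := by
      have e3 : Complex.exp x * w = Complex.exp (x * I) := by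
        rw [hw, ← Complex.exp_add]; ring_nf
      have e4 : Complex.exp x * v = Complex.exp (-x * I) := by
        rw [hv, ← Complex.exp_add]; ring_nf
      have e5 : Complex.exp x * (v * w) = Complex.exp (-x) := by
        rw [hw, hv, ← Complex.exp_add, ← Complex.exp_add]; ring_nf
      rw [Complex.cos, Complex.cosh]
      linear_combination (-1 / 2) * e3 - e4 / 2 + e5 / 2
    have hv1 : 1 - v ≠ 0 := fun h ↦ by rw [← sub_eq_zero.1 h] at hvn; simp at hvn
    have hw1 : 1 - w ≠ 0 := fun h ↦ by rw [← sub_eq_zero.1 h] at hwn; simp at hwn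
    have e5 : v * w = Complex.exp (-x) ^ 2 := by
      rw [hw, hv, ← Complex.exp_add, ← Complex.exp_nat_mul]; push_cast; ring_nf
    have e6 : Complex.exp x * Complex.exp (-x) = 1 := by simp [← Complex.exp_add]
    rw [e2, show -8 * Complex.exp (-x) * (v / (1 - v) ^ 3 * (w / (1 - w) ^ 3)) =
      -8 * Complex.exp (-x) * (v * w) / ((1 - v) ^ 3 * (1 - w) ^ 3) by field_simp, e5,
      eq_inv_of_mul_eq_one_left e6]
    field_simp
    ring

theorem hasSum_integral_cos_sub_cosh :
    HasSum (fun p : ℕ × ℕ ↦ (8 * 11 ! : ℂ) * (((2 * p.1 + 1) ^ 2 - 1) * ((2 * p.2 + 1) ^ 2 - 1)) /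
      ((2 * p.2 + 1) + (2 * p.1 + 1) * I) ^ 12)
      ((∫ x in Ioi (0 : ℝ), x ^ 11 / (Real.cos x - Real.cosh x) ^ 3 : ℝ) : ℂ) := by
  set c : ℕ × ℕ → ℂ := fun p ↦ -8 * (((p.1 + 1).choose 2 : ℂ) * ((p.2 + 1).choose 2 : ℂ)) with hc
  set l : ℕ × ℕ → ℂ := fun p ↦ p.1 + p.2 + 1 - I * (p.2 - p.1) with hl
  have hre (p : ℕ × ℕ) : (l p).re = p.1 + p.2 + 1 := by simp [hl]
  have hpos (p : ℕ × ℕ) : 0 < (l p).re := by rw [hre]; positivity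
  have h := hasSum_integral_of_summable_integral_norm (μ := volume.restrict (Ioi (0 : ℝ)))
    (F := fun p : ℕ × ℕ ↦ fun x : ℝ ↦ c p * ((x : ℂ) ^ 11 * Complex.exp (-(l p * x))))
    (fun p ↦ (integrableOn_pow_mul_exp_neg_mul 11 (hpos p)).const_mul _) ?_
  · convert! h using 1
    · ext p
      rw [integral_const_mul, integral_pow_mul_exp_neg_mul 11 (hpos p)]
      have hl0 : l p ≠ 0 := fun h0 ↦ by have := hpos p; simp [h0] at this
      have e : ((2 * p.2 + 1) + (2 * p.1 + 1) * I) = (1 + I) * l p := by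
        simp only [hl]; linear_combination (p.2 - p.1 : ℂ) * Complex.I_sq
      have e2 : (1 + I) ^ 12 = -64 := by
        have : (1 + I) ^ 2 = 2 * I := by linear_combination Complex.I_sq
        rw [show 12 = 2 * 6 by rfl, pow_mul, this, mul_pow, show 6 = 2 * 3 by rfl,
          pow_mul I, Complex.I_sq]
        norm_num
      rw [e, mul_pow, e2]
      simp only [hc, Nat.cast_choose_two]
      push_cast
      field_simp
      ring
    · rw [← integral_complex_ofReal]
      refine setIntegral_congr_fun measurableSet_Ioi fun x hx ↦ ?_
      have h1 := ((hasSum_inv_cos_sub_cosh_cubed hx).mul_left ((x : ℂ) ^ 11)).tsum_eq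
      push_cast
      rw [div_eq_mul_one_div, ← h1]
      refine tsum_congr fun p ↦ ?_
      simp only [hc, hl]
      ring
  · have h2 : Summable fun n : ℕ ↦ 1 / ((n : ℝ) + 1) ^ 4 := by
      simpa using (summable_nat_add_iff 1).2 (Real.summable_one_div_nat_pow.2 (by norm_num : 1 < 4))
    have h4 := (h2.mul_of_nonneg h2 (fun _ ↦ by positivity) (fun _ ↦ by positivity)).mul_left
      (8 * 11 ! : ℝ)
    refine h4.of_nonneg_of_le (fun p ↦ by positivity) fun p ↦ ?_
    simp_rw [norm_mul (c p), integral_const_mul]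
    rw [integral_pow_mul_exp_neg_mul_norm 11 (hpos p), hre]
    have hcn : ‖c p‖ = 8 * (((p.1 + 1).choose 2 : ℝ) * ((p.2 + 1).choose 2 : ℝ)) := by
      simp [hc]
    rw [hcn, Nat.cast_choose_two, Nat.cast_choose_two]
    push_cast
    set a : ℝ := (p.1 : ℝ)
    set b : ℝ := (p.2 : ℝ)
    have ha : 0 ≤ a := by positivity
    have hb : 0 ≤ b := by positivity
    rw [show (8 : ℝ) * ((a + 1) * (a + 1 - 1) / 2 * ((b + 1) * (b + 1 - 1) / 2)) *
      (11 ! / (a + b + 1) ^ (11 + 1)) = (8 * 11 !) *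
        (((a + 1) * (a + 1 - 1) / 2 * ((b + 1) * (b + 1 - 1) / 2)) / (a + b + 1) ^ 12) by ring,
      one_div_mul_one_div]
    refine mul_le_mul_of_nonneg_left ?_ (by positivity)
    rw [div_le_div_iff₀ (by positivity) (by positivity), one_mul]
    calc _ ≤ (a + b + 1) * (a + b + 1) * ((a + b + 1) * (a + b + 1)) *
          ((a + b + 1) ^ 4 * (a + b + 1) ^ 4) := by
          gcongr <;> nlinarith
      _ = _ := by ring

theorem hasSum_inv_add_int_pow {k : ℕ} (hk : 1 ≤ k) (z : UpperHalfPlane) :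
    HasSum (fun l : ℤ ↦ 1 / ((z : ℂ) + l) ^ (k + 1)) (((-2 * π * I) ^ (k + 1) / k !) *
      ∑' n : ℕ+, (n : ℂ) ^ k * Complex.exp (2 * π * I * z) ^ (n : ℕ)) := by
  rw [← EisensteinSeries.qExpansion_identity_pnat hk]
  refine Summable.hasSum ?_
  refine (EisensteinSeries.linear_right_summable (z : ℂ) 1 (k := k + 1) (by lia)).congr fun l ↦ ?_
  rw [one_div, Int.cast_one, one_mul]
  norm_cast

theorem hasSum_int_odd_sq_sub_one (k : ℕ) :
    HasSum (fun l : ℤ ↦ (8 * 11 ! : ℂ) * (((2 * k + 1) ^ 2 - 1) * ((2 * l + 1) ^ 2 - 1)) /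
        ((2 * l + 1) + (2 * k + 1) * I) ^ 12)
      (8 * (-110 * π ^ 10 *
          ((2 * k + 1 : ℂ) ^ 2 *
              ∑' n : ℕ+, (n : ℂ) ^ 9 * ((-Complex.exp (-π)) ^ (2 * k + 1)) ^ (n : ℕ) -
            (2 * k + 1 : ℂ) ^ 0 *
              ∑' n : ℕ+, (n : ℂ) ^ 9 * ((-Complex.exp (-π)) ^ (2 * k + 1)) ^ (n : ℕ)) +
        22 * π ^ 11 *
          ((2 * k + 1 : ℂ) ^ 3 *
              ∑' n : ℕ+, (n : ℂ) ^ 10 * ((-Complex.exp (-π)) ^ (2 * k + 1)) ^ (n : ℕ) -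
            (2 * k + 1 : ℂ) ^ 1 *
              ∑' n : ℕ+, (n : ℂ) ^ 10 * ((-Complex.exp (-π)) ^ (2 * k + 1)) ^ (n : ℕ)) -
        π ^ 12 *
          ((2 * k + 1 : ℂ) ^ 4 *
              ∑' n : ℕ+, (n : ℂ) ^ 11 * ((-Complex.exp (-π)) ^ (2 * k + 1)) ^ (n : ℕ) -
            (2 * k + 1 : ℂ) ^ 0 *
              ∑' n : ℕ+, (n : ℂ) ^ 11 * ((-Complex.exp (-π)) ^ (2 * k + 1)) ^ (n : ℕ)))) := by
  have him : 0 < ((1 + (2 * k + 1) * I) / 2 : ℂ).im := by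
    simp
    positivity
  set z : UpperHalfPlane := ⟨(1 + (2 * k + 1) * I) / 2, him⟩ with hz
  have hzc : (z : ℂ) = (1 + (2 * k + 1) * I) / 2 := rfl
  have hq : Complex.exp (2 * π * I * z) = (-Complex.exp (-π)) ^ (2 * k + 1) := by
    rw [hzc, Odd.neg_pow ⟨k, rfl⟩, ← Complex.exp_nat_mul]
    rw [show 2 * π * I * ((1 + (2 * k + 1) * I) / 2) =
      ((2 * k + 1 : ℕ) : ℂ) * -π + π * I by
        push_cast
        linear_combination (2 * k + 1 : ℂ) * π * Complex.I_sq, Complex.exp_add,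
      Complex.exp_pi_mul_I, mul_neg_one]
  have h9 := hasSum_inv_add_int_pow (k := 9) (by norm_num) z
  have h10 := hasSum_inv_add_int_pow (k := 10) (by norm_num) z
  have h11 := hasSum_inv_add_int_pow (k := 11) (by norm_num) z
  rw [hq] at h9 h10 h11
  have h := (((h9.mul_left (1 / 2 ^ 10)).sub
    (h10.mul_left (2 * (2 * k + 1 : ℂ) * I / 2 ^ 11))).sub
    (h11.mul_left (((2 * k + 1 : ℂ) ^ 2 + 1) / 2 ^ 12))).mul_left
    ((8 * 11 ! : ℂ) * ((2 * k + 1) ^ 2 - 1))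
  convert! h using 1
  · ext l
    have e : ((2 * l + 1) + (2 * k + 1) * I : ℂ) = 2 * ((z : ℂ) + l) := by
      rw [hzc]; ring
    have e2 : (2 * l + 1 : ℂ) ^ 2 - 1 = 4 * ((z : ℂ) + l) ^ 2 -
        4 * (2 * k + 1) * I * ((z : ℂ) + l) - ((2 * k + 1) ^ 2 + 1) := by
      rw [hzc]; linear_combination (2 * k + 1 : ℂ) ^ 2 * Complex.I_sq
    have hne : (z : ℂ) + l ≠ 0 := fun h0 ↦ by
      have := congrArg Complex.im h0
      simp [z.im_pos.ne'] at this
    rw [e, e2]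
    have e10 : 1 / ((z : ℂ) + l) ^ (9 + 1) = ((z : ℂ) + l) ^ 2 / ((z : ℂ) + l) ^ 12 := by
      field_simp
    have e11 : 1 / ((z : ℂ) + l) ^ (10 + 1) = ((z : ℂ) + l) / ((z : ℂ) + l) ^ 12 := by
      field_simp
    rw [e10, e11, mul_pow]
    generalize (8 * 11 ! : ℂ) = c
    generalize (z : ℂ) + l = W
    generalize (2 * k + 1 : ℂ) = M
    ring
  · have e10 : (-2 * π * I) ^ 10 = -(2 * π) ^ 10 := by
      have : I ^ 10 = -1 := by
        rw [show 10 = 2 * 5 by rfl, pow_mul, Complex.I_sq]; norm_num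
      rw [mul_pow, this]; ring
    have e11 : (-2 * π * I) ^ 11 = (2 * π) ^ 11 * I := by
      rw [pow_succ, e10]; ring
    have e12 : (-2 * π * I) ^ 12 = (2 * π) ^ 12 := by
      rw [pow_succ, e11]; linear_combination -(2 * π : ℂ) ^ 12 * Complex.I_sq
    have f9 : (9 ! : ℂ) = 362880 := by norm_num [Nat.factorial]
    have f10 : (10 ! : ℂ) = 3628800 := by norm_num [Nat.factorial]
    have f11 : (11 ! : ℂ) = 39916800 := by norm_num [Nat.factorial]
    rw [e10, e11, e12, f9, f10, f11]
    generalize (∑' n : ℕ+, (n : ℂ) ^ 9 * ((-Complex.exp (-π)) ^ (2 * k + 1)) ^ (n : ℕ)) = S9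
    generalize (∑' n : ℕ+, (n : ℂ) ^ 10 * ((-Complex.exp (-π)) ^ (2 * k + 1)) ^ (n : ℕ)) = S10
    generalize (∑' n : ℕ+, (n : ℂ) ^ 11 * ((-Complex.exp (-π)) ^ (2 * k + 1)) ^ (n : ℕ)) = S11
    generalize (2 * k + 1 : ℂ) = M
    linear_combination (8 * 22 * M * (M ^ 2 - 1) * π ^ 11 * S10 : ℂ) * Complex.I_sq

theorem hasSum_two_mul_integral_cos_sub_cosh :
    HasSum (fun k : ℕ ↦ 8 * (-110 * π ^ 10 *
          ((2 * k + 1 : ℂ) ^ 2 *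
              ∑' n : ℕ+, (n : ℂ) ^ 9 * ((-Complex.exp (-π)) ^ (2 * k + 1)) ^ (n : ℕ) -
            (2 * k + 1 : ℂ) ^ 0 *
              ∑' n : ℕ+, (n : ℂ) ^ 9 * ((-Complex.exp (-π)) ^ (2 * k + 1)) ^ (n : ℕ)) +
        22 * π ^ 11 *
          ((2 * k + 1 : ℂ) ^ 3 *
              ∑' n : ℕ+, (n : ℂ) ^ 10 * ((-Complex.exp (-π)) ^ (2 * k + 1)) ^ (n : ℕ) -
            (2 * k + 1 : ℂ) ^ 1 *
              ∑' n : ℕ+, (n : ℂ) ^ 10 * ((-Complex.exp (-π)) ^ (2 * k + 1)) ^ (n : ℕ)) -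
        π ^ 12 *
          ((2 * k + 1 : ℂ) ^ 4 *
              ∑' n : ℕ+, (n : ℂ) ^ 11 * ((-Complex.exp (-π)) ^ (2 * k + 1)) ^ (n : ℕ) -
            (2 * k + 1 : ℂ) ^ 0 *
              ∑' n : ℕ+, (n : ℂ) ^ 11 * ((-Complex.exp (-π)) ^ (2 * k + 1)) ^ (n : ℕ))))
      (2 * ((∫ x in Ioi (0 : ℝ), x ^ 11 / (Real.cos x - Real.cosh x) ^ 3 : ℝ) : ℂ)) := by
  have h := hasSum_integral_cos_sub_cosh
  have h' := Complex.hasSum_conj'.2 h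
  rw [Complex.conj_ofReal] at h'
  have hr := h.prod_fiberwise fun k ↦ (h.summable.prod_factor k).hasSum
  have hr' := h'.prod_fiberwise fun k ↦ (h'.summable.prod_factor k).hasSum
  have hrr := hr.add hr'
  rw [← two_mul] at hrr
  refine hrr.congr_fun fun k ↦ ?_
  refine (hasSum_int_odd_sq_sub_one k).unique
    (HasSum.of_nat_of_neg_add_one ?_ ?_)
  · convert! (h.summable.prod_factor k).hasSum using 1
  · convert! (h'.summable.prod_factor k).hasSum using 1
    ext j
    have hc : starRingEnd ℂ (8 * 11 ! : ℂ) = 8 * 11 ! := by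
      rw [map_mul, Complex.conj_natCast, map_ofNat]
    rw [map_div₀, map_mul, hc]
    generalize (8 * 11 ! : ℂ) = c
    simp only [map_mul, map_pow, map_sub, map_add, map_one, Complex.conj_I, map_natCast, map_ofNat]
    push_cast
    rw [← Even.neg_pow (by decide : Even 12) ((2 * (j : ℂ) + 1) + (2 * k + 1) * -I)]
    rw [show -((2 * (j : ℂ) + 1) + (2 * k + 1) * -I) = 2 * -(j + 1) + 1 + (2 * k + 1) * I by ring,
      show (2 * -((j : ℂ) + 1) + 1) ^ 2 = (2 * j + 1) ^ 2 by ring]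

end IntegralAsLatticeSum

section DivisorSums

open Filter Topology

lemma summable_prod_mul_pow_mul_pow (a b : ℕ) {r : ℂ} (hr : ‖r‖ < 1) :
    Summable fun c : ℕ+ × ℕ+ ↦ (c.1 : ℂ) ^ b * ((c.2 : ℂ) ^ a * r ^ (c.1 * c.2 : ℕ)) := by
  obtain ⟨s, hs, hs1⟩ := exists_between hr
  have hs0 : 0 < s := (norm_nonneg r).trans_lt hs
  have ht : |‖r‖ / s| < 1 := by
    rw [abs_of_nonneg (by positivity)]
    exact (div_lt_one hs0).mpr hs
  obtain ⟨C, hC⟩ := (tendsto_pow_const_mul_const_pow_of_abs_lt_one b ht).bddAbove_range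
  have key := ((summable_prod_mul_pow a (r := (s : ℂ)) (by
    simpa [abs_of_pos hs0] using hs1)).norm.mul_left C)
  refine Summable.of_norm_bounded key fun c ↦ ?_
  have h1 : ((c.1 * c.2 : ℕ) : ℝ) ^ b * (‖r‖ / s) ^ (c.1 * c.2 : ℕ) ≤ C := hC ⟨_, rfl⟩
  have h2 : ((c.1 : ℕ) : ℝ) ^ b ≤ ((c.1 * c.2 : ℕ) : ℝ) ^ b := by
    gcongr
    exact Nat.le_mul_of_pos_right _ c.2.pos
  have h3 : ‖r‖ ^ (c.1 * c.2 : ℕ) = (‖r‖ / s) ^ (c.1 * c.2 : ℕ) * s ^ (c.1 * c.2 : ℕ) := by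
    rw [← mul_pow, div_mul_cancel₀ _ hs0.ne']
  simp only [norm_mul, norm_pow, Complex.norm_natCast, Complex.norm_real, Real.norm_eq_abs,
    abs_of_pos hs0]
  rw [h3]
  calc ((c.1 : ℕ) : ℝ) ^ b * (((c.2 : ℕ) : ℝ) ^ a *
        ((‖r‖ / s) ^ (c.1 * c.2 : ℕ) * s ^ (c.1 * c.2 : ℕ)))
      ≤ ((c.1 * c.2 : ℕ) : ℝ) ^ b * (((c.2 : ℕ) : ℝ) ^ a *
        ((‖r‖ / s) ^ (c.1 * c.2 : ℕ) * s ^ (c.1 * c.2 : ℕ))) := by gcongr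
    _ = (((c.1 * c.2 : ℕ) : ℝ) ^ b * (‖r‖ / s) ^ (c.1 * c.2 : ℕ)) *
        (((c.2 : ℕ) : ℝ) ^ a * s ^ (c.1 * c.2 : ℕ)) := by ring
    _ ≤ _ := by gcongr

lemma hasSum_pow_mul_tsum (a b : ℕ) (hab : b ≤ a) {r : ℂ} (hr : ‖r‖ < 1) :
    HasSum (fun m : ℕ+ ↦ (m : ℂ) ^ b * ∑' n : ℕ+, (n : ℂ) ^ a * (r ^ (m : ℕ)) ^ (n : ℕ))
      (∑' e : ℕ, (e : ℂ) ^ b * ArithmeticFunction.sigma (a - b) e * r ^ e) := by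
  have hs := summable_prod_mul_pow_mul_pow a b hr
  have h1 : HasSum (fun m : ℕ+ ↦ (m : ℂ) ^ b * ∑' n : ℕ+, (n : ℂ) ^ a * (r ^ (m : ℕ)) ^ (n : ℕ))
      (∑' c : ℕ+ × ℕ+, (c.1 : ℂ) ^ b * ((c.2 : ℂ) ^ a * r ^ (c.1 * c.2 : ℕ))) := by
    have := hs.hasSum.prod_fiberwise (fun m ↦ (hs.prod_factor m).hasSum)
    simpa only [tsum_mul_left, pow_mul] using this
  convert h1 using 1
  have hs' := sigmaAntidiagonalEquivProd.summable_iff.mpr hs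
  rw [← sigmaAntidiagonalEquivProd.tsum_eq]
  change _ = ∑' c, ((fun c : ℕ+ × ℕ+ ↦ (c.1 : ℂ) ^ b * ((c.2 : ℂ) ^ a * r ^ (c.1 * c.2 : ℕ))) ∘
    sigmaAntidiagonalEquivProd) c
  rw [hs'.tsum_sigma, ← tsum_pnat_eq_tsum_of_eq_zero (by simp)]
  refine tsum_congr fun n ↦ ?_
  simp only [sigmaAntidiagonalEquivProd, divisorsAntidiagonalFactors, Equiv.coe_fn_mk,
    Function.comp_apply, PNat.mk_coe, tsum_fintype, Finset.univ_eq_attach]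
  rw [(n : ℕ).divisorsAntidiagonal.sum_attach
    fun x : ℕ × ℕ ↦ (x.1 : ℂ) ^ b * ((x.2 : ℂ) ^ a * r ^ (x.1 * x.2)),
    ArithmeticFunction.sigma_eq_sum_div]
  push_cast
  rw [Finset.mul_sum, Finset.sum_mul,
    Nat.sum_divisorsAntidiagonal fun x y ↦ (x : ℂ) ^ b * ((y : ℂ) ^ a * r ^ (x * y))]
  refine Finset.sum_congr rfl fun i hi ↦ ?_
  have hi' := Nat.mul_div_cancel' (Nat.dvd_of_mem_divisors hi)
  rw [hi', show ((n : ℕ) : ℂ) = (i : ℂ) * ((n / i : ℕ) : ℂ) by exact_mod_cast hi'.symm, mul_pow,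
    mul_assoc, mul_assoc, ← mul_assoc _ _ (r ^ (n : ℕ)), ← pow_add, Nat.add_sub_cancel' hab]

lemma hasSum_odd (a b : ℕ) (hab : b ≤ a) {r : ℂ} (hr : ‖r‖ < 1) :
    HasSum (fun j : ℕ ↦ (2 * j + 1 : ℂ) ^ b *
        ∑' n : ℕ+, (n : ℂ) ^ a * (r ^ (2 * j + 1)) ^ (n : ℕ))
      ((∑' e : ℕ, (e : ℂ) ^ b * ArithmeticFunction.sigma (a - b) e * r ^ e) -
        2 ^ b * ∑' e : ℕ, (e : ℂ) ^ b * ArithmeticFunction.sigma (a - b) e * (r ^ 2) ^ e) := by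
  have hr2 : ‖r ^ 2‖ < 1 := by
    rw [norm_pow]; exact pow_lt_one₀ (norm_nonneg _) hr two_ne_zero
  have h1 := hasSum_pow_mul_tsum a b hab hr
  have h2 := (hasSum_pow_mul_tsum a b hab hr2).mul_left (2 ^ b)
  set f : ℕ → ℂ := fun m ↦ (m : ℂ) ^ b * ∑' n : ℕ+, (n : ℂ) ^ a * (r ^ m) ^ (n : ℕ) with hf
  have h1' : HasSum (fun k : ℕ ↦ f (k + 1)) _ :=
    (Equiv.pnatEquivNat.symm.hasSum_iff (f := fun m : ℕ+ ↦ f m)).mpr h1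
  have h2' : HasSum (fun k : ℕ ↦ f ((2 * k + 1) + 1))
      (2 ^ b * ∑' e : ℕ, (e : ℂ) ^ b * ArithmeticFunction.sigma (a - b) e * (r ^ 2) ^ e) := by
    have := (Equiv.pnatEquivNat.symm.hasSum_iff).mpr h2
    refine this.congr_fun fun k ↦ ?_
    have hk : (((Equiv.pnatEquivNat.symm k : ℕ+) : ℕ)) = k + 1 := rfl
    simp only [hf, Function.comp_apply, hk, ← pow_mul]
    rw [← mul_assoc, ← mul_pow, show 2 * k + 1 + 1 = 2 * (k + 1) by ring]
    push_cast
    rfl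
  have hodd : Summable (fun k : ℕ ↦ f (2 * k + 1)) := 
    h1'.summable.comp_injective (i := fun k ↦ 2 * k) (mul_right_injective₀ two_ne_zero)
  have := hodd.hasSum.even_add_odd (f := fun k ↦ f (k + 1)) h2'
  have := h1'.unique this
  rw [this, add_sub_cancel_right]
  convert! hodd.hasSum using 3
  simp

end DivisorSums

section ModularForms

open UpperHalfPlane hiding I
open ModularForm EisensteinSeries Derivative Filter Topology Complex
open scoped Manifold MatrixGroups

lemma norm_mul_cexp_pow_le (c : ℂ) (m : ℕ) {w w₀ : ℂ} (h : w₀.im ≤ w.im) :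
    ‖c * cexp (2 * π * I * w) ^ m‖ ≤ ‖c * cexp (2 * π * I * w₀) ^ m‖ := by
  rw [norm_mul, norm_mul, norm_pow, norm_pow]
  have : ‖cexp (2 * π * I * w)‖ ≤ ‖cexp (2 * π * I * w₀)‖ := by
    rw [Complex.norm_exp, Complex.norm_exp, Real.exp_le_exp]
    simp [mul_assoc]
    nlinarith [Real.pi_pos]
  gcongr

/-- Termwise normalized derivative of a `q`-expansion. -/
lemma hasSum_normalizedDeriv {f : ℍ → ℂ} {c : ℕ → ℂ}
    (hf : ∀ z : ℍ, HasSum (fun m : ℕ ↦ c m * cexp (2 * π * I * z) ^ m) (f z)) (z : ℍ) :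
    HasSum (fun m : ℕ ↦ (m * c m) * cexp (2 * π * I * z) ^ m)
      (normalizedDerivOfComplex f z) := by
  set y₀ : ℍ := ⟨(z.im / 2 : ℝ) * I, by simpa using z.im_pos⟩ with hy₀
  set U : Set ℂ := {w | z.im / 2 < w.im} with hU
  have hzU : (z : ℂ) ∈ U := by
    have := z.im_pos
    simp only [hU, Set.mem_ofPred_eq, coe_im]; linarith
  have hUo : IsOpen U := isOpen_lt continuous_const Complex.continuous_im
  have hle (m : ℕ) (w : ℂ) (hw : w ∈ U) : ‖c m * cexp (2 * π * I * w) ^ m‖ ≤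
      ‖c m * cexp (2 * π * I * y₀) ^ m‖ := by
    refine norm_mul_cexp_pow_le _ _ ?_
    simp only [hU, Set.mem_ofPred_eq] at hw
    simpa [hy₀] using hw.le
  have key := Complex.hasSum_deriv_of_summable_norm (U := U) (z := z)
    (F := fun (m : ℕ) (w : ℂ) ↦ c m * cexp (2 * π * I * w) ^ m)
    (hf y₀).summable.norm (fun m ↦ by fun_prop) hUo hle hzU
  have hd (m : ℕ) : deriv (fun w ↦ c m * cexp (2 * π * I * w) ^ m) z =
      2 * π * I * ((m * c m) * cexp (2 * π * I * z) ^ m) := by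
    have h1 : HasDerivAt (fun w : ℂ ↦ c m * cexp (m * (2 * π * I) * w))
        (c m * (cexp (m * (2 * π * I) * z) * (m * (2 * π * I)))) z := by
      have := ((hasDerivAt_id (z : ℂ)).const_mul (m * (2 * π * I))).cexp.const_mul (c m)
      simpa using this
    have h2 (w : ℂ) : cexp (2 * π * I * w) ^ m = cexp (m * (2 * π * I) * w) := by
      rw [← Complex.exp_nat_mul]; ring_nf
    simp_rw [h2]
    rw [h1.deriv]; ring
  simp_rw [hd] at key
  have hpi : (2 * π * I : ℂ) ≠ 0 := by simp [Real.pi_ne_zero]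
  have heq : deriv (fun w : ℂ ↦ ∑' m : ℕ, c m * cexp (2 * π * I * w) ^ m) z =
      deriv (f ∘ ofComplex) z := by
    apply Filter.EventuallyEq.deriv_eq
    filter_upwards [isOpen_upperHalfPlaneSet.mem_nhds z.im_pos] with w hw
    have := (hf ⟨w, hw⟩).tsum_eq
    simp only [Function.comp_apply, ofComplex_apply_of_im_pos hw]
    exact this
  have := key.mul_left (2 * π * I : ℂ)⁻¹
  rw [heq] at this
  exact this.congr_fun (fun m ↦ by field_simp)

lemma tendsto_atImInfty_of_hasSum {f : ℍ → ℂ} {c : ℕ → ℂ}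
    (hf : ∀ z : ℍ, HasSum (fun m : ℕ ↦ c m * cexp (2 * π * I * z) ^ m) (f z)) :
    Tendsto f atImInfty (𝓝 (c 0)) := by
  have hq : Tendsto (fun z : ℍ ↦ cexp (2 * π * I * z)) atImInfty (𝓝 0) := by
    simpa [Function.Periodic.qParam, Function.comp_def] using qParam_tendsto_atImInfty one_pos
  have key := tendsto_tsum_of_dominated_convergence (𝓕 := atImInfty)
    (f := fun (z : ℍ) (m : ℕ) ↦ c m * cexp (2 * π * I * z) ^ m)
    (g := fun m ↦ if m = 0 then c 0 else 0)
    (bound := fun m ↦ ‖c m * cexp (2 * π * I * UpperHalfPlane.I) ^ m‖)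
    (hf UpperHalfPlane.I).summable.norm (fun m ↦ ?_) ?_
  · rw [tsum_ite_eq] at key
    exact key.congr fun z ↦ (hf z).tsum_eq
  · rcases eq_or_ne m 0 with rfl | hm
    · simp
    · simpa [hm] using (hq.pow m).const_mul (c m)
  · filter_upwards [tendsto_comap.eventually_ge_atTop 1] with z hz m
    exact norm_mul_cexp_pow_le _ _ (by simpa using hz)

/-- A level one form of weight less than twelve that vanishes at the cusp is zero. -/
lemma eq_zero_of_tendsto_atImInfty_zero {k : ℤ} (hk : k < 12) {F : ℍ → ℂ} (hF : MDiff F)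
    (hslash : ∀ γ : SL(2, ℤ), F ∣[k] γ = F) (h0 : Tendsto F atImInfty (𝓝 0)) : F = 0 := by
  let f : CuspForm 𝒮ℒ k :=
    { toFun := F
      slash_action_eq' := by
        rintro _ ⟨γ, rfl⟩
        exact hslash γ
      holo' := hF
      zero_at_cusps' := fun {c} hc ↦ by
        rw [OnePoint.isZeroAt_iff_forall_SL2Z hc]
        intro γ _
        rw [hslash γ]
        exact h0 }
  have := rank_zero_iff_forall_zero.mp (CuspForm.rank_eq_zero_of_weight_lt_twelve hk) f
  exact congrArg DFunLike.coe this

lemma hasSum_E {k : ℕ} (hk : 3 ≤ k) (hk2 : Even k) (z : ℍ) :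
    HasSum (fun m : ℕ ↦ (if m = 0 then 1 else -(2 * k / bernoulli k : ℂ) *
      (ArithmeticFunction.sigma (k - 1) m)) * cexp (2 * π * I * z) ^ m) (E hk z) := by
  have := ModularForm.hasSum_qExpansion (f := E hk) one_pos one_mem_strictPeriods_SL z
  simp_rw [E_qExpansion_coeff hk hk2] at this
  simpa [Function.Periodic.qParam] using this

lemma hasSum_E2 (z : ℍ) :
    HasSum (fun m : ℕ ↦ (if m = 0 then 1 else -24 * (ArithmeticFunction.sigma 1 m) : ℂ) *
      cexp (2 * π * I * z) ^ m) (E2 z) := by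
  have := hasSum_qExpansion_E2 (z := z)
  simpa [Function.Periodic.qParam] using this

lemma E_slash {k : ℕ} (hk : 3 ≤ k) (γ : SL(2, ℤ)) : (E hk : ℍ → ℂ) ∣[(k : ℤ)] γ = E hk :=
  SlashInvariantForm.slash_action_eqn (E hk) _ ⟨γ, rfl⟩

lemma E2_slash_eq (γ : SL(2, ℤ)) :
    E2 ∣[(2 : ℤ)] γ = fun z ↦ E2 z - 6 * I / π * (γ 1 0 / denom γ z) := by
  rw [E2_slash_action]
  ext z
  simp only [D2, riemannZeta_two, Pi.sub_apply, Pi.smul_apply, smul_eq_mul]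
  field_simp

lemma normalizedDeriv_E2_slash (γ : SL(2, ℤ)) :
    (normalizedDerivOfComplex E2 - (12⁻¹ : ℂ) • (E2 * E2)) ∣[(4 : ℤ)] γ =
      normalizedDerivOfComplex E2 - (12⁻¹ : ℂ) • (E2 * E2) := by
  set x : ℍ → ℂ := fun z ↦ γ 1 0 / denom γ z with hx
  have hE : E2 ∣[(2 : ℤ)] γ = fun z ↦ E2 z - 6 * I / π * x z := E2_slash_eq γ
  have hD := normalizedDerivOfComplex_SL_slash (k := 2) E2_mdifferentiable (γ := γ)
  have hD' (z : ℍ) : normalizedDerivOfComplex (E2 ∣[(2 : ℤ)] γ) z =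
      normalizedDerivOfComplex E2 z + 6 * I / π * (2 * π * I)⁻¹ * x z ^ 2 := by
    rw [hE]
    have hne : ((γ 1 0 : ℤ) * (z : ℂ) + (γ 1 1 : ℤ) : ℂ) ≠ 0 := by
      have := denom_ne_zero γ z
      rwa [ModularGroup.denom_apply] at this
    have h1 : HasDerivAt (fun w : ℂ ↦ 6 * I / π * ((γ 1 0 : ℂ) / (γ 1 0 * w + γ 1 1)))
        (6 * I / π * -(x z ^ 2)) (z : ℂ) := by
      have := (((hasDerivAt_id (z : ℂ)).const_mul (γ 1 0 : ℂ)).add_const (γ 1 1 : ℂ))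
      have := ((this.inv hne).const_mul (γ 1 0 : ℂ)).const_mul (6 * I / π : ℂ)
      refine (this.congr_deriv ?_).congr_of_eventuallyEq (.of_eq ?_)
      · simp only [hx, ModularGroup.denom_apply, id]
        field_simp
      · ext w
        simp [div_eq_mul_inv]
    have h2 : HasDerivAt (E2 ∘ ofComplex) (deriv (E2 ∘ ofComplex) z) (z : ℂ) :=
      (UpperHalfPlane.mdifferentiableAt_iff.mp (E2_mdifferentiable z)).hasDerivAt
    have h3 := (h2.sub h1).congr_of_eventuallyEq (f₁ :=
      (fun z ↦ E2 z - 6 * I / π * x z) ∘ ofComplex) (by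
        filter_upwards [isOpen_upperHalfPlaneSet.mem_nhds z.im_pos] with w hw
        simp [hx, ModularGroup.denom_apply, ofComplex_apply_of_im_pos hw])
    simp only [normalizedDerivOfComplex]
    rw [h3.deriv]
    ring
  have hmul := mul_slash_SL2 2 2 γ E2 E2
  rw [show (2 : ℤ) + 2 = 4 by norm_num] at hD hmul
  ext z
  have hDz := congrFun hD z
  have hmz := congrFun hmul z
  rw [hD' z] at hDz
  have hEz := congrFun hE z
  simp only [sub_eq_add_neg, SlashAction.add_slash, SlashAction.neg_slash, SL_smul_slash]
  simp only [Pi.add_apply, Pi.neg_apply, Pi.smul_apply, smul_eq_mul, Pi.mul_apply,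
    Pi.sub_apply] at hDz hmz ⊢
  rw [hmz, hEz]
  rw [hEz] at hDz
  change _ = _ - _ * _ * x z * _ at hDz
  have hinv : (2 * π * I : ℂ)⁻¹ = -I / (2 * π) := by
    field_simp
    simp
  rw [hinv] at hDz
  push_cast at hDz
  linear_combination -hDz

lemma tendsto_E {k : ℕ} (hk : 3 ≤ k) (hk2 : Even k) : Tendsto (E hk) atImInfty (𝓝 1) := by
  simpa using tendsto_atImInfty_of_hasSum (hasSum_E hk hk2)

lemma tendsto_normalizedDeriv_E {k : ℕ} (hk : 3 ≤ k) (hk2 : Even k) :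
    Tendsto (normalizedDerivOfComplex (E hk)) atImInfty (𝓝 0) := by
  simpa using tendsto_atImInfty_of_hasSum (hasSum_normalizedDeriv (hasSum_E hk hk2))

lemma tendsto_E2 : Tendsto E2 atImInfty (𝓝 1) := by
  simpa using tendsto_atImInfty_of_hasSum hasSum_E2

lemma tendsto_normalizedDeriv_E2 : Tendsto (normalizedDerivOfComplex E2) atImInfty (𝓝 0) := by
  simpa using tendsto_atImInfty_of_hasSum (hasSum_normalizedDeriv hasSum_E2)

lemma mdiff_E {k : ℕ} (hk : 3 ≤ k) : MDiff (E hk : ℍ → ℂ) := (E hk).holo'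

/-- Ramanujan's identity for the derivative of `E2`. -/
lemma normalizedDeriv_E2 (z : ℍ) :
    normalizedDerivOfComplex E2 z = (E2 z ^ 2 - E₄ z) / 12 := by
  have h := eq_zero_of_tendsto_atImInfty_zero (k := 4) (by norm_num)
    (F := normalizedDerivOfComplex E2 - (12⁻¹ : ℂ) • (E2 * E2) + (12⁻¹ : ℂ) • (E₄ : ℍ → ℂ))
    (((normalizedDerivOfComplex_mdifferentiable E2_mdifferentiable).sub
      ((E2_mdifferentiable.mul E2_mdifferentiable).const_smul _)).add ((mdiff_E _).const_smul _))
    (fun γ ↦ by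
      rw [SlashAction.add_slash, normalizedDeriv_E2_slash, SL_smul_slash,
        show (E₄ : ℍ → ℂ) ∣[(4 : ℤ)] γ = E₄ from E_slash (k := 4) (by norm_num) γ]) (by
      have := (tendsto_normalizedDeriv_E2.sub ((tendsto_E2.mul tendsto_E2).const_smul
        (12⁻¹ : ℂ))).add ((tendsto_E (k := 4) (by norm_num) (by decide)).const_smul (12⁻¹ : ℂ))
      convert! this using 2
      simp)
  have := congrFun h z
  simp only [Pi.add_apply, Pi.sub_apply, Pi.smul_apply, Pi.mul_apply, smul_eq_mul,
    Pi.zero_apply] at this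
  linear_combination this

lemma normalizedDeriv_E_eq {k l : ℕ} (hk : 3 ≤ k) (hk2 : Even k) (hl : 3 ≤ l) (hl2 : Even l)
    (hkl : k + 2 = l) (hk12 : l < 12) (z : ℍ) :
    normalizedDerivOfComplex (E hk) z = k / 12 * (E2 z * E hk z - E hl z) := by
  subst hkl
  have h := eq_zero_of_tendsto_atImInfty_zero (k := ((k + 2 : ℕ) : ℤ)) (by exact_mod_cast hk12)
    (F := serreDerivative k (E hk) + (k / 12 : ℂ) • (E hl : ℍ → ℂ))
    ((serreDerivative_mdifferentiable _ (mdiff_E _)).add ((mdiff_E _).const_smul _))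
    (fun γ ↦ by
      rw [SlashAction.add_slash, SL_smul_slash, E_slash]
      exact congrArg (· + _) (serreDerivative_slash_invariant (k := k) (mdiff_E _) (E_slash hk γ)))
    (by
      have := ((tendsto_normalizedDeriv_E hk hk2).sub ((tendsto_E2.const_mul
        (k * 12⁻¹ : ℂ)).mul (tendsto_E hk hk2))).add ((tendsto_E hl hl2).const_smul (k / 12 : ℂ))
      convert! this using 2
      simp
      ring)
  have := congrFun h z
  simp only [Pi.add_apply, Pi.smul_apply, smul_eq_mul,
    Pi.zero_apply, serreDerivative_apply] at this
  linear_combination this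

lemma E_mul_eq {k l m : ℕ} (hk : 3 ≤ k) (hk2 : Even k) (hl : 3 ≤ l) (hl2 : Even l)
    (hm : 3 ≤ m) (hm2 : Even m) (hkl : m = k + l) (hm12 : m < 12) (z : ℍ) :
    E hm z = E hk z * E hl z := by
  have h := eq_zero_of_tendsto_atImInfty_zero (k := m) (by exact_mod_cast hm12)
    (F := (E hm : ℍ → ℂ) - (E hk : ℍ → ℂ) * (E hl : ℍ → ℂ))
    ((mdiff_E _).sub ((mdiff_E _).mul (mdiff_E _)))
    (fun γ ↦ by
      have := mul_slash_SL2 k l γ (E hk) (E hl)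
      rw [E_slash, E_slash, ← Nat.cast_add, ← hkl] at this
      rw [sub_eq_add_neg, SlashAction.add_slash, SlashAction.neg_slash, E_slash, this])
    (by
      have := (tendsto_E hm hm2).sub ((tendsto_E hk hk2).mul (tendsto_E hl hl2))
      convert! this using 2
      simp)
  have := congrFun h z
  simp only [Pi.sub_apply, Pi.mul_apply, Pi.zero_apply] at this
  linear_combination this

lemma bernoulli'_six : bernoulli' 6 = 1 / 42 := by
  have h5 : bernoulli' 5 = 0 := bernoulli'_eq_zero_of_odd (by decide) (by norm_num)
  rw [bernoulli'_def]
  norm_num [Finset.sum_range_succ, h5, Nat.choose]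

lemma bernoulli'_eight : bernoulli' 8 = -1 / 30 := by
  have h5 : bernoulli' 5 = 0 := bernoulli'_eq_zero_of_odd (by decide) (by norm_num)
  have h7 : bernoulli' 7 = 0 := bernoulli'_eq_zero_of_odd (by decide) (by norm_num)
  rw [bernoulli'_def]
  norm_num [Finset.sum_range_succ, h5, h7, bernoulli'_six, Nat.choose]

lemma bernoulli'_ten : bernoulli' 10 = 5 / 66 := by
  have h5 : bernoulli' 5 = 0 := bernoulli'_eq_zero_of_odd (by decide) (by norm_num)
  have h7 : bernoulli' 7 = 0 := bernoulli'_eq_zero_of_odd (by decide) (by norm_num)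
  have h9 : bernoulli' 9 = 0 := bernoulli'_eq_zero_of_odd (by decide) (by norm_num)
  rw [bernoulli'_def]
  norm_num [Finset.sum_range_succ, h5, h7, h9, bernoulli'_six, bernoulli'_eight, Nat.choose]

lemma bernoulli'_twelve : bernoulli' 12 = -691 / 2730 := by
  have h5 : bernoulli' 5 = 0 := bernoulli'_eq_zero_of_odd (by decide) (by norm_num)
  have h7 : bernoulli' 7 = 0 := bernoulli'_eq_zero_of_odd (by decide) (by norm_num)
  have h9 : bernoulli' 9 = 0 := bernoulli'_eq_zero_of_odd (by decide) (by norm_num)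
  have h11 : bernoulli' 11 = 0 := bernoulli'_eq_zero_of_odd (by decide) (by norm_num)
  rw [bernoulli'_def]
  norm_num [Finset.sum_range_succ, h5, h7, h9, h11, bernoulli'_six, bernoulli'_eight,
    bernoulli'_ten, Nat.choose]

lemma bernoulli_twelve : bernoulli 12 = -691 / 2730 := by
  rw [bernoulli, bernoulli'_twelve]; norm_num

lemma E_twelve_eq (z : ℍ) : E (k := 12) (by norm_num) z =
    (441 * E₄ z ^ 3 + 250 * E₆ z ^ 2) / 691 := by
  set f : ModularForm 𝒮ℒ 12 := E (k := 12) (by norm_num) -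
    ((441 / 691 : ℂ) • ModularForm.mcast (by decide) (E₄.pow 3) +
      (250 / 691 : ℂ) • ModularForm.mcast (by decide) (E₆.pow 2)) with hf
  have hq : qExpansion 1 f = qExpansion 1 (E (k := 12) (by norm_num)) -
      ((441 / 691 : ℂ) • (qExpansion 1 E₄ * qExpansion 1 E₄ * qExpansion 1 E₄) +
      (250 / 691 : ℂ) • (qExpansion 1 E₆ * qExpansion 1 E₆)) := by
    rw [hf, FunLike.coe_sub, ModularForm.qExpansion_sub one_pos one_mem_strictPeriods_SL,
      FunLike.coe_add, ModularForm.qExpansion_add one_pos one_mem_strictPeriods_SL,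
      FunLike.coe_smul, ModularForm.qExpansion_smul one_pos one_mem_strictPeriods_SL,
      FunLike.coe_smul, ModularForm.qExpansion_smul one_pos one_mem_strictPeriods_SL,
      coe_mcast, coe_mcast, ModularForm.qExpansion_pow one_pos one_mem_strictPeriods_SL,
      ModularForm.qExpansion_pow one_pos one_mem_strictPeriods_SL, pow_three', sq]
  have h0 : (qExpansion 1 f).coeff 0 = 0 := by
    rw [hq]
    simp [PowerSeries.coeff_mul, -PowerSeries.coeff_zero_eq_constantCoeff,
      E_qExpansion_coeff_zero _ ⟨2, rfl⟩, E_qExpansion_coeff_zero _ ⟨3, rfl⟩,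
      E_qExpansion_coeff_zero _ ⟨6, rfl⟩]
    norm_num
  have h1 : (qExpansion 1 f).coeff 1 = 0 := by
    rw [hq]
    norm_num [PowerSeries.coeff_mul, Finset.Nat.antidiagonal_succ, E₄_qExpansion_coeff_one,
      E₆_qExpansion_coeff_one, E_qExpansion_coeff_zero _ ⟨2, rfl⟩,
      E_qExpansion_coeff_zero _ ⟨3, rfl⟩, E_qExpansion_coeff_zero _ ⟨6, rfl⟩,
      E_qExpansion_coeff (k := 12) (by norm_num) ⟨6, rfl⟩, bernoulli_twelve]
  have hf0 : f = 0 := by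
    refine sturm_bound_levelOne (lt_of_lt_of_le ?_ (PowerSeries.le_order _ 2 fun i hi ↦ ?_))
    · exact_mod_cast (by decide : Int.toNat 12 / 12 < 2)
    · have : i < 2 := by exact_mod_cast hi
      interval_cases i
      exacts [h0, h1]
  have h := congrFun (congrArg DFunLike.coe hf0) z
  simp only [hf, FunLike.coe_sub, FunLike.coe_add, FunLike.coe_smul, coe_mcast, coe_pow,
    Pi.sub_apply, Pi.add_apply, Pi.smul_apply, smul_eq_mul, Pi.pow_apply, FunLike.coe_zero,
    Pi.zero_apply] at h
  linear_combination h

lemma hasDerivAt_comp_ofComplex {f : ℍ → ℂ} (hf : MDiff f) (z : ℍ) :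
    HasDerivAt (f ∘ ofComplex) (2 * π * I * normalizedDerivOfComplex f z) (z : ℂ) := by
  have := (UpperHalfPlane.mdifferentiableAt_iff.mp (hf z)).hasDerivAt
  convert! this using 1
  have : (π : ℂ) ≠ 0 := by simp [Real.pi_ne_zero]
  simp only [normalizedDerivOfComplex]
  field_simp

lemma normalizedDeriv_eq_of_hasDerivAt {f : ℍ → ℂ} {z : ℍ} {c : ℂ}
    (h : HasDerivAt (f ∘ ofComplex) (2 * π * I * c) (z : ℂ)) :
    normalizedDerivOfComplex f z = c := by
  have : (π : ℂ) ≠ 0 := by simp [Real.pi_ne_zero]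
  simp only [normalizedDerivOfComplex]
  rw [h.deriv]
  field_simp

lemma hasDerivAt_E2_E4_E6 (z : ℍ) :
    HasDerivAt (E2 ∘ ofComplex) (2 * π * I * ((E2 z ^ 2 - E₄ z) / 12)) (z : ℂ) ∧
    HasDerivAt ((E₄ : ℍ → ℂ) ∘ ofComplex) (2 * π * I * ((E2 z * E₄ z - E₆ z) / 3)) (z : ℂ) ∧
    HasDerivAt ((E₆ : ℍ → ℂ) ∘ ofComplex) (2 * π * I * ((E2 z * E₆ z - E₄ z ^ 2) / 2)) (z : ℂ) := by
  refine ⟨?_, ?_, ?_⟩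
  · rw [← normalizedDeriv_E2]
    exact hasDerivAt_comp_ofComplex E2_mdifferentiable z
  · convert! hasDerivAt_comp_ofComplex (mdiff_E (k := 4) (by norm_num)) z using 2
    rw [normalizedDeriv_E_eq (l := 6) (by norm_num) (by decide) (by norm_num) (by decide) rfl
      (by norm_num)]
    push_cast; ring
  · convert! hasDerivAt_comp_ofComplex (mdiff_E (k := 6) (by norm_num)) z using 2
    rw [normalizedDeriv_E_eq (l := 8) (by norm_num) (by decide) (by norm_num) (by decide) rfl
      (by norm_num), E_mul_eq (k := 4) (l := 4) (by norm_num) (by decide) (by norm_num)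
      (by decide) (by norm_num) (by decide) rfl (by norm_num)]
    push_cast; ring

lemma normalizedDeriv_E4_sq :
    normalizedDerivOfComplex (fun z ↦ (1) * (E₄ z ^ 2)) =
      fun z ↦ (2/3) * (E2 z ^ 1 * E₄ z ^ 2) + (-2/3) * (E₄ z ^ 1 * E₆ z ^ 1) := by
  ext z
  obtain ⟨hP, hQ, hR⟩ := hasDerivAt_E2_E4_E6 z
  refine normalizedDeriv_eq_of_hasDerivAt
    (((hQ.pow 2).const_mul (1 : ℂ)).congr_deriv ?_)
  simp only [Function.comp_apply, ofComplex_apply]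
  push_cast
  ring

lemma normalizedDeriv_two_E4_sq :
    normalizedDerivOfComplex (fun z ↦
        (2/3) * (E2 z ^ 1 * E₄ z ^ 2) + (-2/3) * (E₄ z ^ 1 * E₆ z ^ 1)) =
      fun z ↦ (1/2) * (E2 z ^ 2 * E₄ z ^ 2) + (5/18) * (E₄ z ^ 3) + (-1) * (E2 z ^ 1 * E₄ z ^ 1 * E₆
        z ^ 1) + (2/9) * (E₆ z ^ 2) := by
  ext z
  obtain ⟨hP, hQ, hR⟩ := hasDerivAt_E2_E4_E6 z
  refine normalizedDeriv_eq_of_hasDerivAt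
    (((((hP.pow 1).mul (hQ.pow 2)).const_mul (2/3 : ℂ)).add (((hQ.pow 1).mul (hR.pow
      1)).const_mul (-2/3 : ℂ))).congr_deriv ?_)
  simp only [Function.comp_apply, ofComplex_apply, Pi.pow_apply]
  push_cast
  ring

lemma normalizedDeriv_three_E4_sq :
    normalizedDerivOfComplex (fun z ↦ (1/2) * (E2 z ^ 2 * E₄ z ^ 2) + (5/18) * (E₄ z ^ 3) +
      (-1) * (E2 z ^ 1 * E₄ z ^ 1 * E₆ z ^ 1) + (2/9) * (E₆ z ^ 2)) =
      fun z ↦ (5/12) * (E2 z ^ 3 * E₄ z ^ 2) + (25/36) * (E2 z ^ 1 * E₄ z ^ 3) + (-5/4) * (E2 z ^ 2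
        * E₄ z ^ 1 * E₆ z ^ 1) + (-5/12) * (E₄ z ^ 2 * E₆ z ^ 1) + (5/9) * (E2 z ^ 1 * E₆ z ^
        2) := by
  ext z
  obtain ⟨hP, hQ, hR⟩ := hasDerivAt_E2_E4_E6 z
  refine normalizedDeriv_eq_of_hasDerivAt
    (((((((hP.pow 2).mul (hQ.pow 2)).const_mul (1/2 : ℂ)).add ((hQ.pow 3).const_mul (5/18 :
      ℂ))).add ((((hP.pow 1).mul (hQ.pow 1)).mul (hR.pow 1)).const_mul (-1 : ℂ))).add ((hR.pow
      2).const_mul (2/9 : ℂ))).congr_deriv ?_)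
  simp only [Function.comp_apply, ofComplex_apply, Pi.pow_apply, Pi.mul_apply]
  push_cast
  ring

lemma normalizedDeriv_four_E4_sq :
    normalizedDerivOfComplex (fun z ↦ (5/12) * (E2 z ^ 3 * E₄ z ^ 2) +
      (25/36) * (E2 z ^ 1 * E₄ z ^ 3) + (-5/4) * (E2 z ^ 2 * E₄ z ^ 1 * E₆ z ^ 1) + (-5/12) * (E₄ z ^ 2 * E₆ z ^ 1) + (5/9) * (E2 z ^ 1 * E₆ z ^ 2)) =
      fun z ↦ (55/144) * (E2 z ^ 4 * E₄ z ^ 2) + (275/216) * (E2 z ^ 2 * E₄ z ^ 3) + (-55/36) * (E2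
        z ^ 3 * E₄ z ^ 1 * E₆ z ^ 1) + (65/432) * (E₄ z ^ 4) + (-55/36) * (E2 z ^ 1 * E₄ z ^ 2
        * E₆ z ^ 1) + (55/54) * (E2 z ^ 2 * E₆ z ^ 2) + (25/108) * (E₄ z ^ 1 * E₆ z ^ 2) := by
  ext z
  obtain ⟨hP, hQ, hR⟩ := hasDerivAt_E2_E4_E6 z
  refine normalizedDeriv_eq_of_hasDerivAt
    ((((((((hP.pow 3).mul (hQ.pow 2)).const_mul (5/12 : ℂ)).add (((hP.pow 1).mul (hQ.pow
      3)).const_mul (25/36 : ℂ))).add ((((hP.pow 2).mul (hQ.pow 1)).mul (hR.pow 1)).const_mul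
      (-5/4 : ℂ))).add (((hQ.pow 2).mul (hR.pow 1)).const_mul (-5/12 : ℂ))).add (((hP.pow
      1).mul (hR.pow 2)).const_mul (5/9 : ℂ))).congr_deriv ?_)
  simp only [Function.comp_apply, ofComplex_apply, Pi.pow_apply, Pi.mul_apply]
  push_cast
  ring

lemma normalizedDeriv_E4_mul_E6 :
    normalizedDerivOfComplex (fun z ↦ (1) * (E₄ z ^ 1 * E₆ z ^ 1)) =
      fun z ↦ (5/6) * (E2 z ^ 1 * E₄ z ^ 1 * E₆ z ^ 1) + (-1/3) * (E₆ z ^ 2) +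
        (-1/2) * (E₄ z ^ 3) := by
  ext z
  obtain ⟨hP, hQ, hR⟩ := hasDerivAt_E2_E4_E6 z
  refine normalizedDeriv_eq_of_hasDerivAt
    ((((hQ.pow 1).mul (hR.pow 1)).const_mul (1 : ℂ)).congr_deriv ?_)
  simp only [Function.comp_apply, ofComplex_apply, Pi.pow_apply]
  push_cast
  ring

end ModularForms

section SpecialValues
open UpperHalfPlane hiding I
open ModularForm EisensteinSeries Derivative Filter Topology Complex
open scoped Manifold MatrixGroups

/-- The point `(1 + i) / 2` of the upper half-plane. -/
noncomputable def halfOneAddI : ℍ := ⟨(1 + I) / 2, by simp⟩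

lemma coe_halfOneAddI : (halfOneAddI : ℂ) = (1 + I) / 2 := rfl

lemma denom_S_I : denom (ModularGroup.S : SL(2, ℤ)) UpperHalfPlane.I = Complex.I := by
  rw [ModularGroup.denom_apply]
  simp [ModularGroup.S]

lemma S_smul_I : ModularGroup.S • UpperHalfPlane.I = UpperHalfPlane.I := by
  ext1
  rw [modular_S_smul]
  simp

lemma denom_TS_halfOneAddI :
    denom (ModularGroup.T * ModularGroup.S : SL(2, ℤ)) halfOneAddI = (1 + I) / 2 := by
  rw [ModularGroup.denom_apply, coe_halfOneAddI]
  simp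

lemma TS_smul_halfOneAddI :
    (ModularGroup.T * ModularGroup.S) • halfOneAddI = UpperHalfPlane.I := by
  rw [mul_smul]
  ext1
  rw [modular_S_smul, modular_T_smul]
  simp [coe_halfOneAddI]
  have : (1 + I) ≠ 0 := fun h ↦ by simpa using congrArg Complex.re h
  field_simp
  linear_combination -I_sq

lemma E6_I : E₆ UpperHalfPlane.I = 0 := by
  have := congrFun (E_slash (k := 6) (by norm_num) ModularGroup.S) UpperHalfPlane.I
  rw [SL_slash_apply, S_smul_I, denom_S_I] at this
  norm_num [zpow_neg] at this
  have h6 : I ^ 6 = -1 := by linear_combination (I ^ 4 - I ^ 2 + 1) * I_sq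
  rw [h6] at this
  change E₆ _ * _ = E₆ _ at this
  linear_combination (-1 / 2 : ℂ) * this

lemma E2_I : E2 UpperHalfPlane.I = 3 / π := by
  have := congrFun (E2_slash_eq ModularGroup.S) UpperHalfPlane.I
  rw [SL_slash_apply, S_smul_I, denom_S_I] at this
  have h1 : (ModularGroup.S : SL(2, ℤ)) 1 0 = 1 := by simp [ModularGroup.S]
  rw [h1, zpow_neg, zpow_ofNat, I_sq] at this
  have hp : (π : ℂ) ≠ 0 := by exact_mod_cast pi_ne_zero
  field_simp at this ⊢
  have hI := I_ne_zero
  push_cast at this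
  linear_combination (-1 / 2 : ℂ) * this

lemma E_halfOneAddI {k : ℕ} (hk : 3 ≤ k) :
    E hk halfOneAddI = E hk UpperHalfPlane.I * (((1 + I) / 2) ^ k)⁻¹ := by
  have := congrFun (E_slash hk (ModularGroup.T * ModularGroup.S)) halfOneAddI
  rw [SL_slash_apply, TS_smul_halfOneAddI, denom_TS_halfOneAddI] at this
  rw [← this, zpow_neg, zpow_natCast]

lemma E4_halfOneAddI : E₄ halfOneAddI = -4 * E₄ UpperHalfPlane.I := by
  rw [E_halfOneAddI, show ((1 + I) / 2) ^ 4 = -1 / 4 by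
    linear_combination (1/16 * (I ^ 2 + 4 * I + 5)) * I_sq]
  ring

lemma E6_halfOneAddI : E₆ halfOneAddI = 0 := by
  rw [E_halfOneAddI, E6_I, zero_mul]

lemma E2_halfOneAddI : E2 halfOneAddI = 6 / π := by
  have := congrFun (E2_slash_eq (ModularGroup.T * ModularGroup.S)) halfOneAddI
  rw [SL_slash_apply, TS_smul_halfOneAddI, denom_TS_halfOneAddI, E2_I] at this
  have h1 : (ModularGroup.T * ModularGroup.S : SL(2, ℤ)) 1 0 = 1 := by
    simp
  have hp : (π : ℂ) ≠ 0 := by exact_mod_cast pi_ne_zero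
  have hi : (1 + I) ≠ 0 := fun h ↦ by simpa using congrArg Complex.re h
  rw [h1, zpow_neg, zpow_ofNat, show ((1 + I) / 2) ^ 2 = I / 2 by
    linear_combination (1/4) * I_sq] at this
  have h2 : (1 + I)⁻¹ = (1 - I) / 2 := by
    field_simp
    linear_combination I_sq
  simp only [div_eq_mul_inv, mul_inv, inv_inv, h2, inv_I] at this
  push_cast at this
  linear_combination -this - 6 * (π : ℂ)⁻¹ * I_sq

end SpecialValues

section GaussianPeriods
open UpperHalfPlane hiding I
open ModularForm EisensteinSeries Filter Topology Complex ComplexConjugate PeriodPair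

/-- The period pair `(i, 1)`, spanning the Gaussian integers. -/
noncomputable def gaussianPeriods : PeriodPair where
  ω₁ := I
  ω₂ := 1
  indep := by
    rw [LinearIndependent.pair_iff]
    intro s t h
    have h1 := congrArg Complex.re h
    have h2 := congrArg Complex.im h
    simp at h1 h2
    exact ⟨h2, h1⟩

lemma mem_gaussianPeriods_lattice {z : ℂ} :
    z ∈ gaussianPeriods.lattice ↔ ∃ m n : ℤ, m * I + n = z := by
  simp [mem_lattice, gaussianPeriods]

lemma gaussianPeriods_G {k : ℕ} (hk : 3 ≤ k) :
    gaussianPeriods.G k = 2 * riemannZeta k * E hk UpperHalfPlane.I := by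
  have h := tsum_eisSummand_eq_riemannZeta_mul_eisensteinSeries hk UpperHalfPlane.I
  have hE : E hk UpperHalfPlane.I = (1 / 2 : ℂ) • eisensteinSeries (N := 1) 0 k UpperHalfPlane.I :=
    rfl
  rw [hE, smul_eq_mul, show ∀ a b : ℂ, 2 * a * (1 / 2 * b) = a * b by intros; ring, ← h, G,
    ← (gaussianPeriods.latticeEquivProd.symm.toEquiv).tsum_eq, ← (finTwoArrowEquiv ℤ).tsum_eq]
  refine tsum_congr fun v ↦ ?_
  have h1 : ((gaussianPeriods.latticeEquivProd.symm (v 0, v 1) : gaussianPeriods.lattice) :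
      ℂ) = v 0 * I + v 1 :=
    (latticeEquiv_symm_apply _ _).trans (by simp [gaussianPeriods])
  simp [eisSummand, h1]

lemma gaussianPeriods_g₂ : gaussianPeriods.g₂ = 4 / 3 * π ^ 4 * E₄ UpperHalfPlane.I := by
  rw [g₂, gaussianPeriods_G (k := 4) (by norm_num)]
  push_cast
  rw [riemannZeta_four]
  ring

lemma gaussianPeriods_g₃ : gaussianPeriods.g₃ = 0 := by
  rw [g₃, gaussianPeriods_G (k := 6) (by norm_num), show E _ UpperHalfPlane.I = 0 from E6_I]
  simp

lemma exists_E4_I_eq_ofReal : ∃ c : ℝ, 0 < c ∧ E₄ UpperHalfPlane.I = c := by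
  have h := hasSum_E (k := 4) (by norm_num) (by decide) UpperHalfPlane.I
  have hq : cexp (2 * π * I * UpperHalfPlane.I) = (rexp (-(2 * π)) : ℝ) := by
    rw [UpperHalfPlane.coe_I, mul_assoc, I_mul_I]
    push_cast
    ring_nf
  have h4 : (bernoulli 4 : ℂ) = -1 / 30 := by
    rw [bernoulli, bernoulli'_four]; norm_num
  have h' : HasSum (fun m : ℕ ↦ (((if m = 0 then 1 else 240 * ArithmeticFunction.sigma 3 m) *
      rexp (-(2 * π)) ^ m : ℝ) : ℂ)) (E₄ UpperHalfPlane.I) := by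
    refine h.congr_fun fun m ↦ ?_
    rw [hq, h4]
    split_ifs
    · simp
    · push_cast
      ring
  have hs : Summable (fun m : ℕ ↦ ((if m = 0 then 1 else 240 * ArithmeticFunction.sigma 3 m) *
      rexp (-(2 * π)) ^ m : ℝ)) := Complex.summable_ofReal.mp h'.summable
  refine ⟨_, hs.tsum_pos (fun m ↦ ?_) 0 (by simp), ?_⟩
  · positivity
  · rw [ofReal_tsum]
    exact h'.tsum_eq.symm

end GaussianPeriods

section EllipticODE
open Filter Topology Set MeasureTheory

variable {p p' : ℝ → ℝ} {e : ℝ}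

lemma le_of_deriv_sq_eq (he : 0 < e) (hp : ∀ x ∈ Ioo (0 : ℝ) 1, HasDerivAt p (p' x) x)
    (hode : ∀ x ∈ Ioo (0 : ℝ) 1, p' x ^ 2 = 4 * p x ^ 3 - 4 * e ^ 2 * p x)
    (htop : Tendsto p (𝓝[>] 0) atTop) {x : ℝ} (hx : x ∈ Ioo (0 : ℝ) 1) : e ≤ p x := by
  obtain ⟨x₀, hx₀, hx₀'⟩ := ((htop.eventually_gt_atTop e).and
    (Ioo_mem_nhdsGT (one_pos : (0 : ℝ) < 1))).exists
  by_contra! h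
  have h0 : p x ≤ 0 := by
    by_contra! h'
    nlinarith [hode x hx, sq_nonneg (p' x), mul_pos h' (sub_pos.2 h),
      mul_pos (mul_pos h' (sub_pos.2 h)) (add_pos h' he)]
  obtain ⟨y, hy, hye⟩ := isPreconnected_Ioo.intermediate_value hx hx₀'
    (fun y hy ↦ (hp y hy).continuousAt.continuousWithinAt) (show e / 2 ∈ Icc (p x) (p x₀) by
      constructor <;> linarith)
  have := hode y hy
  rw [hye] at this
  nlinarith [sq_nonneg (p' y), pow_pos he 3]

lemma eq_of_deriv_eq_zero (he : 0 < e) (hp : ∀ x ∈ Ioo (0 : ℝ) 1, HasDerivAt p (p' x) x)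
    (hode : ∀ x ∈ Ioo (0 : ℝ) 1, p' x ^ 2 = 4 * p x ^ 3 - 4 * e ^ 2 * p x)
    (htop : Tendsto p (𝓝[>] 0) atTop) {x : ℝ} (hx : x ∈ Ioo (0 : ℝ) 1) (h : p' x = 0) :
    p x = e := by
  have hle := le_of_deriv_sq_eq he hp hode htop hx
  have h1 := hode x hx
  rw [h] at h1
  have h2 : (p x * (p x + e)) * (p x - e) = 0 := by linear_combination -h1 / 4
  have h3 : p x * (p x + e) ≠ 0 := by
    have : 0 < p x := he.trans_le hle
    positivity
  linarith [(mul_eq_zero.mp h2).resolve_left h3]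

lemma deriv_half_eq_zero (hp : ∀ x ∈ Ioo (0 : ℝ) 1, HasDerivAt p (p' x) x)
    (hsymm : ∀ x, p (1 - x) = p x) : p' (1 / 2) = 0 := by
  have h1 := hp (1 / 2) (by norm_num)
  have h2 : HasDerivAt (fun x ↦ p (1 - x)) (-p' (1 / 2)) (1 / 2) := by
    have h : HasDerivAt p (p' (1 / 2)) (1 - 1 / 2) := by norm_num at h1 ⊢; exact h1
    simpa using h.comp_const_sub 1 (1 / 2)
  rw [funext hsymm] at h2
  linarith [h1.unique h2]

lemma deriv_neg_of_deriv_sq_eq (he : 0 < e) (hp : ∀ x ∈ Ioo (0 : ℝ) 1, HasDerivAt p (p' x) x)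
    (hode : ∀ x ∈ Ioo (0 : ℝ) 1, p' x ^ 2 = 4 * p x ^ 3 - 4 * e ^ 2 * p x)
    (hsymm : ∀ x, p (1 - x) = p x) (htop : Tendsto p (𝓝[>] 0) atTop)
    (hne : ∀ a ∈ Ioo (0 : ℝ) (1 / 2), ¬ ∀ x ∈ Ioo a (1 - a), p x = e)
    {x : ℝ} (hx : x ∈ Ioo (0 : ℝ) (1 / 2)) : p' x < 0 := by
  have hle {y : ℝ} (hy : y ∈ Ioo (0 : ℝ) 1) : e ≤ p y := le_of_deriv_sq_eq he hp hode htop hy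
  have h0 : ∀ a ∈ Ioo (0 : ℝ) (1 / 2), p' a ≠ 0 := by
    intro a ha h
    have hpa : p a = e :=
      eq_of_deriv_eq_zero he hp hode htop ⟨ha.1, by linarith [ha.2]⟩ h
    have hsub : Icc a (1 - a) ⊆ Ioo 0 1 := fun y hy ↦
      ⟨by linarith [ha.1, hy.1], by linarith [ha.1, hy.2]⟩
    obtain ⟨m, hm, hmax⟩ := isCompact_Icc.exists_isMaxOn (s := Icc a (1 - a))
      ⟨a, le_rfl, by linarith [ha.2]⟩
      (fun y hy ↦ (hp y (hsub hy)).continuousAt.continuousWithinAt)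
    have hpm : p m = e := by
      rcases eq_or_lt_of_le hm.1 with rfl | h1
      · exact hpa
      rcases eq_or_lt_of_le hm.2 with rfl | h2
      · rw [hsymm, hpa]
      have hloc := hmax.isLocalMax (Icc_mem_nhds h1 h2)
      exact eq_of_deriv_eq_zero he hp hode htop (hsub hm)
        (hloc.hasDerivAt_eq_zero (hp m (hsub hm)))
    refine hne a ha fun y hy ↦ le_antisymm ?_ (hle (hsub ⟨hy.1.le, hy.2.le⟩))
    exact hpm ▸ hmax ⟨hy.1.le, hy.2.le⟩
  have hd : ∀ y ∈ Ioo (0 : ℝ) (1 / 2), HasDerivAt p (p' y) y := fun y hy ↦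
    hp y ⟨hy.1, by linarith [hy.2]⟩
  rcases hasDerivWithinAt_forall_lt_or_forall_gt_of_forall_ne (convex_Ioo (0 : ℝ) (1 / 2))
    (fun y hy ↦ (hd y hy).hasDerivWithinAt) h0 with h | h
  · exact h x hx
  · exfalso
    have hmono : MonotoneOn p (Ioo 0 (1 / 2)) := by
      refine monotoneOn_of_deriv_nonneg (convex_Ioo _ _)
        (fun y hy ↦ (hd y hy).continuousAt.continuousWithinAt) ?_ ?_
      · rw [interior_Ioo]
        exact fun y hy ↦ (hd y hy).differentiableAt.differentiableWithinAt
      · rw [interior_Ioo]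
        exact fun y hy ↦ (hd y hy).deriv ▸ (h y hy).le
    obtain ⟨y, hy, hy'⟩ := ((htop.eventually_gt_atTop (p (1 / 4))).and
      (Ioo_mem_nhdsGT (by norm_num : (0 : ℝ) < 1 / 4))).exists
    have := hmono (a := y) (b := 1 / 4) ⟨hy'.1, by linarith [hy'.2]⟩ (by norm_num) hy'.2.le
    linarith

lemma integral_eq_two_mul_sqrt_of_deriv_sq_eq (he : 0 < e)
    (hp : ∀ x ∈ Ioo (0 : ℝ) 1, HasDerivAt p (p' x) x)
    (hode : ∀ x ∈ Ioo (0 : ℝ) 1, p' x ^ 2 = 4 * p x ^ 3 - 4 * e ^ 2 * p x)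
    (hsymm : ∀ x, p (1 - x) = p x) (htop : Tendsto p (𝓝[>] 0) atTop)
    (hne : ∀ a ∈ Ioo (0 : ℝ) (1 / 2), ¬ ∀ x ∈ Ioo a (1 - a), p x = e) :
    ∫ s in Ioo (0 : ℝ) 1, s ^ (-3 / 4 : ℝ) * (1 - s) ^ (-1 / 2 : ℝ) = 2 * √e := by
  have hneg {x : ℝ} (hx : x ∈ Ioo (0 : ℝ) (1 / 2)) : p' x < 0 :=
    deriv_neg_of_deriv_sq_eq he hp hode hsymm htop hne hx
  have hhalf : p (1 / 2) = e :=
    eq_of_deriv_eq_zero he hp hode htop (by norm_num) (deriv_half_eq_zero hp hsymm)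
  have hsub : Ioc (0 : ℝ) (1 / 2) ⊆ Ioo 0 1 := fun y hy ↦ ⟨hy.1, by linarith [hy.2]⟩
  have hanti : StrictAntiOn p (Ioc 0 (1 / 2)) := by
    refine strictAntiOn_of_deriv_neg (convex_Ioc _ _)
      (fun y hy ↦ (hp y (hsub hy)).continuousAt.continuousWithinAt) fun y hy ↦ ?_
    rw [interior_Ioc] at hy
    exact (hp y (hsub (Ioo_subset_Ioc_self hy))).deriv ▸ hneg hy
  have hgt {x : ℝ} (hx : x ∈ Ioo (0 : ℝ) (1 / 2)) : e < p x :=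
    hhalf ▸ hanti (Ioo_subset_Ioc_self hx) (by norm_num) hx.2
  have himage : (fun x ↦ e ^ 2 / p x ^ 2) '' Ioo 0 (1 / 2) = Ioo 0 1 := by
    ext s
    constructor
    · rintro ⟨x, hx, rfl⟩
      have := hgt hx
      have h0 : 0 < p x := he.trans this
      refine ⟨by positivity, ?_⟩
      rw [div_lt_one (by positivity)]
      gcongr
    · rintro ⟨hs0, hs1⟩
      have hs : 0 < √s := Real.sqrt_pos.mpr hs0
      have hs' : √s < 1 := by rw [Real.sqrt_lt' one_pos]; simpa using hs1
      obtain ⟨x₀, hx₀, hx₀'⟩ := ((htop.eventually_gt_atTop (e / √s)).and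
        (Ioo_mem_nhdsGT (by norm_num : (0 : ℝ) < 1 / 2))).exists
      have hlt : e < e / √s := by
        rw [lt_div_iff₀ hs]
        nlinarith
      obtain ⟨x, hx, hxe⟩ := isPreconnected_Ioc.intermediate_value
        (show (1 / 2 : ℝ) ∈ Ioc (0 : ℝ) (1 / 2) by norm_num) (Ioo_subset_Ioc_self hx₀')
        (fun y hy ↦ (hp y (hsub hy)).continuousAt.continuousWithinAt)
        (show e / √s ∈ Icc (p (1 / 2)) (p x₀) from ⟨hhalf ▸ hlt.le, hx₀.le⟩)
      have hx2 : x ≠ 1 / 2 := by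
        rintro rfl
        rw [hhalf] at hxe
        exact hlt.ne hxe
      refine ⟨x, ⟨hx.1, lt_of_le_of_ne hx.2 hx2⟩, ?_⟩
      simp only [hxe, div_pow, Real.sq_sqrt hs0.le]
      field_simp
  have hinj : InjOn (fun x ↦ e ^ 2 / p x ^ 2) (Ioo 0 (1 / 2)) := by
    intro x hx y hy hxy
    have hx0 : 0 < p x := he.trans (hgt hx)
    have hy0 : 0 < p y := he.trans (hgt hy)
    refine hanti.injOn (Ioo_subset_Ioc_self hx) (Ioo_subset_Ioc_self hy) ?_
    simp only at hxy
    field_simp at hxy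
    rw [← Real.sqrt_sq hx0.le, ← Real.sqrt_sq hy0.le, hxy]
  rw [← himage, integral_image_eq_integral_abs_deriv_smul
      (f' := fun x ↦ -2 * e ^ 2 * p' x / p x ^ 3)
    measurableSet_Ioo _ hinj]
  · rw [setIntegral_congr_fun (g := fun _ ↦ 4 * √e) measurableSet_Ioo]
    · simp
      ring
    · intro x hx
      have hpe := hgt hx
      have hp0 : 0 < p x := he.trans hpe
      have hn := hneg hx
      have hr : 0 < p x ^ 2 - e ^ 2 := by nlinarith
      have hp' : |p' x| = 2 * √(p x) * √(p x ^ 2 - e ^ 2) := by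
        rw [← Real.sqrt_sq (abs_nonneg (p' x)), sq_abs,
          hode x (hsub (Ioo_subset_Ioc_self hx)),
          show 4 * p x ^ 3 - 4 * e ^ 2 * p x = 2 ^ 2 * (p x * (p x ^ 2 - e ^ 2)) by ring,
          Real.sqrt_mul (by positivity), Real.sqrt_sq (by norm_num), Real.sqrt_mul hp0.le]
        ring
      have h1 : (e ^ 2 / p x ^ 2) ^ (-3 / 4 : ℝ) = (p x * √(p x)) / (e * √e) := by
        rw [← div_pow, ← Real.rpow_natCast, ← Real.rpow_mul (by positivity),
          show ((2 : ℕ) : ℝ) * (-3 / 4) = -(1 + 1 / 2) by norm_num, Real.rpow_neg (by positivity),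
          Real.rpow_add (by positivity), Real.rpow_one, ← Real.sqrt_eq_rpow,
          Real.sqrt_div he.le]
        field_simp
      have h2 : (1 - e ^ 2 / p x ^ 2) ^ (-1 / 2 : ℝ) = p x / √(p x ^ 2 - e ^ 2) := by
        rw [show 1 - e ^ 2 / p x ^ 2 = (p x ^ 2 - e ^ 2) / p x ^ 2 by field_simp,
          show (-1 / 2 : ℝ) = -(1 / 2) by norm_num, Real.rpow_neg (by positivity),
          ← Real.sqrt_eq_rpow, Real.sqrt_div hr.le, Real.sqrt_sq hp0.le, inv_div]
      have hs1 := Real.sq_sqrt hp0.le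
      have hs2 := Real.sq_sqrt he.le
      have hr' : 0 < √(p x ^ 2 - e ^ 2) := Real.sqrt_pos.mpr hr
      have he' : 0 < √e := Real.sqrt_pos.mpr he
      simp only [smul_eq_mul]
      rw [h1, h2, abs_div, abs_mul, abs_mul, hp', abs_of_pos (pow_pos hp0 3), abs_sq]
      norm_num
      field_simp
      rw [hs1, hs2]
      ring
  · intro x hx
    have hp0 : 0 < p x := he.trans (hgt hx)
    have h := (((hp x (hsub (Ioo_subset_Ioc_self hx))).pow 2).inv (pow_ne_zero 2 hp0.ne')).const_mul
      (e ^ 2)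
    refine (h.congr_deriv ?_).hasDerivWithinAt
    simp only [Pi.pow_apply]
    push_cast
    field_simp

end EllipticODE

section LemniscateConstant
open UpperHalfPlane hiding I
open ModularForm EisensteinSeries Filter Topology Complex ComplexConjugate
open PeriodPair Set MeasureTheory

lemma integral_rpow_mul_rpow_eq_Gamma :
    ∫ s in Ioo (0 : ℝ) 1, s ^ (-3 / 4 : ℝ) * (1 - s) ^ (-1 / 2 : ℝ) =
      Real.Gamma (1 / 4) ^ 2 / √(2 * π) := by
  have h := betaIntegral_eq_Gamma_mul_div (1 / 4) (1 / 2) (by norm_num) (by norm_num)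
  have h2 : betaIntegral (1 / 4) (1 / 2) =
      ((∫ s in Ioo (0 : ℝ) 1, s ^ (-3 / 4 : ℝ) * (1 - s) ^ (-1 / 2 : ℝ) : ℝ) : ℂ) := by
    rw [betaIntegral, intervalIntegral.integral_of_le zero_le_one, integral_Ioc_eq_integral_Ioo,
      ← integral_complex_ofReal]
    refine setIntegral_congr_fun measurableSet_Ioo fun x hx ↦ ?_
    have h1 : (0 : ℝ) ≤ 1 - x := by linarith [hx.2]
    simp only [ofReal_mul, ofReal_cpow hx.1.le, ofReal_cpow h1]
    push_cast
    norm_num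
  have h3 : Complex.Gamma (1 / 4) * Complex.Gamma (1 / 2) / Complex.Gamma (1 / 4 + 1 / 2) =
      ((Real.Gamma (1 / 4) * Real.Gamma (1 / 2) / Real.Gamma (3 / 4) : ℝ) : ℂ) := by
    push_cast [← Complex.Gamma_ofReal]
    norm_num
  rw [h2, h3, ofReal_inj] at h
  have h4 := Real.Gamma_mul_Gamma_one_sub (1 / 4)
  rw [show (1 - 1 / 4 : ℝ) = 3 / 4 by norm_num, show π * (1 / 4) = π / 4 by ring,
    Real.sin_pi_div_four] at h4
  have h5 : 0 < Real.Gamma (1 / 4) := Real.Gamma_pos_of_pos (by norm_num)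
  have h6 : 0 < Real.Gamma (3 / 4) := Real.Gamma_pos_of_pos (by norm_num)
  have h7 : Real.Gamma (3 / 4) = 2 * π / (√2 * Real.Gamma (1 / 4)) := by
    field_simp at h4 ⊢
    linarith
  rw [h, Real.Gamma_one_half_eq, h7, Real.sqrt_mul (by norm_num)]
  have hs2 := Real.sq_sqrt (show (0 : ℝ) ≤ 2 by norm_num)
  have hsp := Real.sq_sqrt pi_pos.le
  have := pi_pos
  field_simp
  rw [hs2, hsp, mul_comm]

/-- The restriction of the Weierstrass function of the Gaussian integers to the real axis. -/
noncomputable def realP (x : ℝ) : ℝ := (gaussianPeriods.weierstrassP x).re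

lemma conj_weierstrassP (z : ℂ) :
    conj (gaussianPeriods.weierstrassP z) = gaussianPeriods.weierstrassP (conj z) := by
  have hmem {w : ℂ} (hw : w ∈ gaussianPeriods.lattice) : conj w ∈ gaussianPeriods.lattice := by
    obtain ⟨m, n, rfl⟩ := mem_gaussianPeriods_lattice.mp hw
    exact mem_gaussianPeriods_lattice.mpr ⟨-m, n, by simp⟩
  let σ : gaussianPeriods.lattice ≃ gaussianPeriods.lattice :=
    ⟨fun w ↦ ⟨conj (w : ℂ), hmem w.2⟩, fun w ↦ ⟨conj (w : ℂ), hmem w.2⟩,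
      fun w ↦ by simp, fun w ↦ by simp⟩
  rw [weierstrassP, weierstrassP, conj_tsum, ← σ.tsum_eq]
  refine tsum_congr fun l ↦ ?_
  simp [σ]

lemma weierstrassP_ofReal (x : ℝ) : gaussianPeriods.weierstrassP x = realP x := by
  have := conj_weierstrassP x
  rw [conj_ofReal, conj_eq_iff_re] at this
  exact this.symm

lemma notMem_lattice_of_re_mem_Ioo {z : ℂ} (hz : z.re ∈ Ioo (0 : ℝ) 1) :
    z ∉ gaussianPeriods.lattice := by
  intro h
  obtain ⟨m, n, rfl⟩ := mem_gaussianPeriods_lattice.mp h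
  simp only [add_re, mul_re, intCast_re, Complex.I_re, mul_zero, intCast_im,
    Complex.I_im, zero_mul, sub_zero,
    zero_add] at hz
  have h1 : (0 : ℤ) < n := by exact_mod_cast hz.1
  have h2 : n < (1 : ℤ) := by exact_mod_cast hz.2
  omega

lemma hasDerivAt_realP {x : ℝ} (hx : x ∈ Ioo (0 : ℝ) 1) :
    HasDerivAt realP (gaussianPeriods.derivWeierstrassP x).re x := by
  have h := ((gaussianPeriods.analyticOnNhd_weierstrassP x
    (notMem_lattice_of_re_mem_Ioo (by simpa using hx))).differentiableAt).hasDerivAt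
  rw [deriv_weierstrassP] at h
  exact h.real_of_complex

lemma derivWeierstrassP_im_eq_zero {x : ℝ} (hx : x ∈ Ioo (0 : ℝ) 1) :
    (gaussianPeriods.derivWeierstrassP x).im = 0 := by
  have h := ((gaussianPeriods.analyticOnNhd_weierstrassP x
    (notMem_lattice_of_re_mem_Ioo (by simpa using hx))).differentiableAt).hasDerivAt
  rw [deriv_weierstrassP] at h
  have h1 := h.comp_ofReal
  have h2 := (hasDerivAt_realP hx).ofReal_comp
  have h3 : (fun y : ℝ ↦ gaussianPeriods.weierstrassP y) = fun y : ℝ ↦ (realP y : ℂ) :=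
    funext weierstrassP_ofReal
  rw [h3] at h1
  rw [h1.unique h2, ofReal_im]

lemma realP_one_sub (x : ℝ) : realP (1 - x) = realP x := by
  have h1 : (1 : ℂ) ∈ gaussianPeriods.lattice := mem_gaussianPeriods_lattice.mpr ⟨0, 1, by simp⟩
  have := gaussianPeriods.weierstrassP_add_coe (-x) ⟨1, h1⟩
  rw [weierstrassP_neg] at this
  rw [realP, realP, ← this]
  push_cast
  ring_nf

lemma tendsto_realP : Tendsto realP (𝓝[>] 0) atTop := by
  have h0 : ∀ z, gaussianPeriods.weierstrassPExcept 0 z + 1 / z ^ 2 =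
      gaussianPeriods.weierstrassP z := fun z ↦ by
    simpa using gaussianPeriods.weierstrassPExcept_add 0 z
  have hc : ContinuousAt (gaussianPeriods.weierstrassPExcept 0) ((0 : ℝ) : ℂ) := by
    simpa using (gaussianPeriods.analyticAt_weierstrassPExcept 0).continuousAt
  have hc' : ContinuousAt (fun x : ℝ ↦ (gaussianPeriods.weierstrassPExcept 0 x).re) 0 :=
    continuous_re.continuousAt.comp (hc.comp continuous_ofReal.continuousAt)
  have h1 : Tendsto (fun x : ℝ ↦ 1 / x ^ 2) (𝓝[>] 0) atTop := by
    have := (tendsto_pow_atTop (two_ne_zero)).comp (tendsto_inv_nhdsGT_zero (𝕜 := ℝ))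
    refine this.congr fun x ↦ by simp
  refine ((hc'.tendsto.mono_left nhdsWithin_le_nhds).add_atTop h1).congr fun x ↦ ?_
  rw [realP, ← h0]
  norm_cast

lemma realP_not_const {e a : ℝ} (ha : a ∈ Ioo (0 : ℝ) (1 / 2)) :
    ¬ ∀ x ∈ Ioo a (1 - a), realP x = e := by
  intro h
  have hU : {z : ℂ | z.re ∈ Ioo (0 : ℝ) 1} ⊆ (gaussianPeriods.lattice : Set ℂ)ᶜ :=
    fun z hz ↦ notMem_lattice_of_re_mem_Ioo hz
  have hconv : Convex ℝ {z : ℂ | z.re ∈ Ioo (0 : ℝ) 1} :=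
    (convex_Ioo (0 : ℝ) 1).is_linear_preimage reLm.isLinear
  have hfreq : ∃ᶠ z in 𝓝[≠] ((1 / 2 : ℝ) : ℂ), gaussianPeriods.weierstrassP z = (e : ℂ) := by
    have h1 : Tendsto (fun x : ℝ ↦ (x : ℂ)) (𝓝[≠] (1 / 2)) (𝓝[≠] ((1 / 2 : ℝ) : ℂ)) :=
      tendsto_nhdsWithin_iff.mpr
        ⟨continuous_ofReal.continuousAt.tendsto.mono_left nhdsWithin_le_nhds,
        eventually_nhdsWithin_of_forall fun x hx ↦ ofReal_injective.ne hx⟩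
    refine h1.frequently (Eventually.frequently ?_)
    filter_upwards [nhdsWithin_le_nhds (Ioo_mem_nhds ha.2 (show 1 / 2 < 1 - a by linarith [ha.2]))]
      with x hx
    rw [weierstrassP_ofReal, h x hx]
  have heq := (gaussianPeriods.analyticOnNhd_weierstrassP.mono
    hU).eqOn_of_preconnected_of_frequently_eq analyticOnNhd_const hconv.isPreconnected (by norm_num) hfreq
  obtain ⟨x, hx, hx'⟩ := ((tendsto_realP.eventually_gt_atTop e).and
    (Ioo_mem_nhdsGT (one_pos : (0 : ℝ) < 1))).exists
  have := heq (show (x : ℂ) ∈ {z : ℂ | z.re ∈ Ioo (0 : ℝ) 1} by simpa using hx')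
  rw [weierstrassP_ofReal, ofReal_inj] at this
  exact hx.ne' this

lemma E4_I : E₄ UpperHalfPlane.I = ((3 * Real.Gamma (1 / 4) ^ 8 / (64 * π ^ 6) : ℝ) : ℂ) := by
  obtain ⟨c, hc, hE⟩ := exists_E4_I_eq_ofReal
  set e : ℝ := √(π ^ 4 * c / 3) with he
  have hpos : 0 < e := Real.sqrt_pos.mpr (by positivity)
  have he2 : e ^ 2 = π ^ 4 * c / 3 := Real.sq_sqrt (by positivity)
  have hode : ∀ x ∈ Ioo (0 : ℝ) 1, (gaussianPeriods.derivWeierstrassP x).re ^ 2 =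
      4 * realP x ^ 3 - 4 * e ^ 2 * realP x := by
    intro x hx
    have h := gaussianPeriods.derivWeierstrassP_sq x
      (notMem_lattice_of_re_mem_Ioo (by simpa using hx))
    have him : gaussianPeriods.derivWeierstrassP x =
        ((gaussianPeriods.derivWeierstrassP x).re : ℂ) := by
      apply Complex.ext <;> simp [derivWeierstrassP_im_eq_zero hx]
    rw [gaussianPeriods_g₂, gaussianPeriods_g₃, hE, him, weierstrassP_ofReal] at h
    have h' : (gaussianPeriods.derivWeierstrassP x).re ^ 2 =
      4 * realP x ^ 3 - 4 / 3 * π ^ 4 * c * realP x - 0 := by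
      apply ofReal_injective
      push_cast
      exact h
    rw [h', he2]
    ring
  have h := integral_eq_two_mul_sqrt_of_deriv_sq_eq hpos (fun x hx ↦ hasDerivAt_realP hx) hode
    realP_one_sub tendsto_realP (fun a ha ↦ realP_not_const ha)
  rw [integral_rpow_mul_rpow_eq_Gamma] at h
  have hp := pi_pos
  rw [hE, ofReal_inj]
  have h8 := congrArg (· ^ 8) h
  simp only [div_pow, mul_pow] at h8
  rw [show √(2 * π) ^ 8 = (√(2 * π) ^ 2) ^ 4 by ring, show √e ^ 8 = ((√e ^ 2) ^ 2) ^ 2 by ring,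
    Real.sq_sqrt hpos.le, Real.sq_sqrt (by positivity), he2] at h8
  have h9 : (π ^ 4 * c / 3) * 16  = Real.Gamma (1 / 4) ^ 8 / (4 * π ^ 2) := by
    refine (pow_left_inj₀ (by positivity) (by positivity) two_ne_zero).mp ?_
    field_simp at h8 ⊢
    linarith
  field_simp at h9 ⊢
  linarith

end LemniscateConstant

section Evaluation
open UpperHalfPlane hiding I
open ModularForm EisensteinSeries Derivative Filter Topology Complex MeasureTheory

lemma hasSum_iterate_normalizedDeriv {f : ℍ → ℂ} {c : ℕ → ℂ}
    (hf : ∀ z : ℍ, HasSum (fun m : ℕ ↦ c m * cexp (2 * π * I * z) ^ m) (f z)) (b : ℕ) (z : ℍ) :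
    HasSum (fun m : ℕ ↦ (m ^ b * c m) * cexp (2 * π * I * z) ^ m)
      (normalizedDerivOfComplex^[b] f z) := by
  induction b generalizing z with
  | zero => simpa using hf z
  | succ b ih =>
    rw [Function.iterate_succ_apply']
    refine (hasSum_normalizedDeriv ih z).congr_fun fun m ↦ ?_
    ring

lemma tsum_pow_mul_sigma {k : ℕ} (hk : 3 ≤ k) (hk2 : Even k) (b : ℕ) (z : ℍ) :
    -(2 * k / bernoulli k : ℂ) * ∑' m : ℕ, (m : ℂ) ^ b * ArithmeticFunction.sigma (k - 1) m *
      cexp (2 * π * I * z) ^ m =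
    normalizedDerivOfComplex^[b] (E hk) z - 0 ^ b := by
  rw [← tsum_mul_left]
  refine HasSum.tsum_eq ?_
  refine ((hasSum_iterate_normalizedDeriv (hasSum_E hk hk2) b z).sub
    (hasSum_ite_eq 0 ((0 : ℂ) ^ b))).congr_fun fun m ↦ ?_
  rcases eq_or_ne m 0 with rfl | hm
  · simp
  · simp only [hm, if_false]
    ring

lemma cexp_halfOneAddI : cexp (2 * π * I * halfOneAddI) = -cexp (-π) := by
  rw [coe_halfOneAddI, show 2 * π * I * ((1 + I) / 2) = π * I + -π by
    linear_combination (π : ℂ) * I_sq, Complex.exp_add, exp_pi_mul_I]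
  ring

lemma cexp_I : cexp (2 * π * I * UpperHalfPlane.I) = (-cexp (-π)) ^ 2 := by
  rw [UpperHalfPlane.coe_I, neg_sq, ← Complex.exp_nat_mul]
  congr 1
  push_cast
  linear_combination (2 * π : ℂ) * I_sq

lemma norm_neg_cexp_neg_pi_lt_one : ‖-cexp (-π)‖ < 1 := by
  rw [norm_neg, Complex.norm_exp]
  simpa using pi_pos

/-- Odd-indexed sums of powers, evaluated through derivatives of Eisenstein series. -/
lemma hasSum_odd_eq {k : ℕ} (hk : 3 ≤ k) (hk2 : Even k) {a b : ℕ} (hab : a = b + (k - 1)) {C : ℂ}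
    (hC : -(2 * k / bernoulli k : ℂ) = C) (hC0 : C ≠ 0) :
    HasSum (fun j : ℕ ↦ (2 * j + 1 : ℂ) ^ b *
        ∑' n : ℕ+, (n : ℂ) ^ a * ((-cexp (-π)) ^ (2 * j + 1)) ^ (n : ℕ))
      ((normalizedDerivOfComplex^[b] (E hk) halfOneAddI - 0 ^ b) / C -
        2 ^ b * ((normalizedDerivOfComplex^[b] (E hk) UpperHalfPlane.I - 0 ^ b) / C)) := by
  have h := hasSum_odd a b (by omega) norm_neg_cexp_neg_pi_lt_one
  rw [← cexp_I, ← cexp_halfOneAddI, show a - b = k - 1 by omega] at h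
  rw [cexp_halfOneAddI] at h
  rw [← tsum_pow_mul_sigma hk hk2, ← tsum_pow_mul_sigma hk hk2, hC, mul_div_cancel_left₀ _ hC0,
    mul_div_cancel_left₀ _ hC0, cexp_halfOneAddI]
  exact h

lemma E_eight : (E (k := 8) (by norm_num) : ℍ → ℂ) = fun z ↦ (1) * (E₄ z ^ 2) := by
  ext z
  rw [E_mul_eq (k := 4) (l := 4) (by norm_num) (by decide) (by norm_num) (by decide) _
    (by decide) rfl (by norm_num)]
  ring

lemma E_ten : (E (k := 10) (by norm_num) : ℍ → ℂ) = fun z ↦ (1) * (E₄ z ^ 1 * E₆ z ^ 1) := by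
  ext z
  rw [E_mul_eq (k := 4) (l := 6) (by norm_num) (by decide) (by norm_num) (by decide) _
    (by decide) rfl (by norm_num)]
  ring

lemma iterate_normalizedDeriv_E_eight {z : ℍ} (h : E₆ z = 0) :
    normalizedDerivOfComplex^[2] (E (k := 8) (by norm_num)) z =
      1 / 2 * E2 z ^ 2 * E₄ z ^ 2 + 5 / 18 * E₄ z ^ 3 ∧
    normalizedDerivOfComplex^[3] (E (k := 8) (by norm_num)) z =
      5 / 12 * E2 z ^ 3 * E₄ z ^ 2 + 25 / 36 * E2 z * E₄ z ^ 3 ∧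
    normalizedDerivOfComplex^[4] (E (k := 8) (by norm_num)) z =
      55 / 144 * E2 z ^ 4 * E₄ z ^ 2 + 275 / 216 * E2 z ^ 2 * E₄ z ^ 3 + 65 / 432 * E₄ z ^ 4 := by
  simp only [Function.iterate_succ_apply, Function.iterate_zero, id, E_eight,
    normalizedDeriv_E4_sq, normalizedDeriv_two_E4_sq, normalizedDeriv_three_E4_sq,
    normalizedDeriv_four_E4_sq, h]
  refine ⟨?_, ?_, ?_⟩ <;> ring

lemma iterate_normalizedDeriv_E_ten {z : ℍ} (h : E₆ z = 0) :
    normalizedDerivOfComplex^[0] (E (k := 10) (by norm_num)) z = 0 ∧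
    normalizedDerivOfComplex^[1] (E (k := 10) (by norm_num)) z = -1 / 2 * E₄ z ^ 3 := by
  simp only [Function.iterate_succ_apply, Function.iterate_zero, id, E_ten,
    normalizedDeriv_E4_mul_E6, h]
  refine ⟨?_, ?_⟩ <;> ring

lemma iterate_normalizedDeriv_E_twelve {z : ℍ} (h : E₆ z = 0) :
    normalizedDerivOfComplex^[0] (E (k := 12) (by norm_num)) z = 441 / 691 * E₄ z ^ 3 := by
  rw [Function.iterate_zero, id, E_twelve_eq, h]
  ring

lemma neg_two_mul_div_bernoulli_eight : -(2 * (8 : ℕ) / bernoulli 8 : ℂ) = 480 := by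
  rw [bernoulli, bernoulli'_eight]; norm_num

lemma neg_two_mul_div_bernoulli_ten : -(2 * (10 : ℕ) / bernoulli 10 : ℂ) = -264 := by
  rw [bernoulli, bernoulli'_ten]; norm_num

lemma neg_two_mul_div_bernoulli_twelve : -(2 * (12 : ℕ) / bernoulli 12 : ℂ) = 65520 / 691 := by
  rw [bernoulli_twelve]; norm_num

end Evaluation

theorem integral_x11_cos_minus_cosh_cubed :
    (∫ x in Set.Ioi (0:ℝ), x ^ 11 / (Real.cos x - Real.cosh x) ^ 3) =
      -(4455 * Real.Gamma (1/4) ^ 16 / (2 ^ 15 * π ^ 4))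
    - 935 * Real.Gamma (1/4) ^ 24 / (2 ^ 20 * π ^ 8)
    + 297 * Real.Gamma (1/4) ^ 24 / (2 ^ 18 * π ^ 7)
    - 189 * Real.Gamma (1/4) ^ 24 / (2 ^ 20 * π ^ 6)
    - 195 * Real.Gamma (1/4) ^ 32 / (2 ^ 27 * π ^ 12) := by
  have h8 {a b : ℕ} (hab : a = b + 7) := hasSum_odd_eq (k := 8) (by norm_num) (by decide) hab
    neg_two_mul_div_bernoulli_eight (by norm_num)
  have h10 {a b : ℕ} (hab : a = b + 9) := hasSum_odd_eq (k := 10) (by norm_num) (by decide) hab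
    neg_two_mul_div_bernoulli_ten (by norm_num)
  have h12 {a b : ℕ} (hab : a = b + 11) := hasSum_odd_eq (k := 12) (by norm_num) (by decide) hab
    neg_two_mul_div_bernoulli_twelve (by norm_num)
  have h := (((((h8 (a := 9) (b := 2) rfl).sub (h10 (a := 9) (b := 0) rfl)).mul_left
    (-110 * (π : ℂ) ^ 10)).add (((h8 (a := 10) (b := 3) rfl).sub
      (h10 (a := 10) (b := 1) rfl)).mul_left (22 * (π : ℂ) ^ 11))).sub
    (((h8 (a := 11) (b := 4) rfl).sub (h12 (a := 11) (b := 0) rfl)).mul_left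
      ((π : ℂ) ^ 12))).mul_left 8
  have hI := hasSum_two_mul_integral_cos_sub_cosh.unique h
  obtain ⟨a2, a3, a4⟩ := iterate_normalizedDeriv_E_eight E6_I
  obtain ⟨b2, b3, b4⟩ := iterate_normalizedDeriv_E_eight E6_halfOneAddI
  obtain ⟨c0, c1⟩ := iterate_normalizedDeriv_E_ten E6_I
  obtain ⟨d0, d1⟩ := iterate_normalizedDeriv_E_ten E6_halfOneAddI
  rw [a2, a3, a4, b2, b3, b4, c0, c1, d0, d1, iterate_normalizedDeriv_E_twelve E6_I,
    iterate_normalizedDeriv_E_twelve E6_halfOneAddI, E2_I, E2_halfOneAddI, E4_halfOneAddI, E4_I]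
    at hI
  apply Complex.ofReal_injective
  generalize Real.Gamma (1 / 4) = G at hI ⊢
  generalize (∫ x in Set.Ioi (0 : ℝ), x ^ 11 / (Real.cos x - Real.cosh x) ^ 3) = J at hI ⊢
  have hp : (π : ℂ) ≠ 0 := by exact_mod_cast pi_ne_zero
  push_cast at hI ⊢
  refine mul_left_cancel₀ two_ne_zero (hI.trans ?_)
  generalize (π : ℂ) = p at hp ⊢
  generalize (G : ℂ) = g
  field_simp
  ring
end

section
/- Σ_{n=0}^∞ (−1)^n (2n+1)^3 / cosh((2n+1)π/2)^3 = −3Γ^4/(2^4 π^5) + Γ^12/(2^10 π^9), where Γ = Γ(1/4). -/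
open Real

section

open UpperHalfPlane hiding I
open Complex ModularForm EisensteinSeries Filter Topology Derivative
open scoped Real Manifold MatrixGroups PeriodPair ComplexConjugate

/-- `E₂` as a function on `ℂ`. -/
noncomputable def eisensteinTwo (z : ℂ) : ℂ := E2 (ofComplex z)

/-- `E₄` as a function on `ℂ`. -/
noncomputable def eisensteinFour (z : ℂ) : ℂ := E₄ (ofComplex z)

lemma hasSum_deriv_of_hasSum_cexp {f : ℂ → ℂ} {c : ℕ → ℂ}
    (h : ∀ z : ℂ, 0 < z.im → HasSum (fun n : ℕ ↦ c n * cexp (2 * π * I * n * z)) (f z))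
    {z : ℂ} (hz : 0 < z.im) :
    HasDerivAt f (deriv f z) z ∧
      HasSum (fun n : ℕ ↦ (2 * π * I * n * c n) * cexp (2 * π * I * n * z)) (deriv f z) := by
  set U : Set ℂ := {w : ℂ | z.im / 2 < w.im} with hUdef
  have hU : IsOpen U := isOpen_lt continuous_const Complex.continuous_im
  have hzU : z ∈ U := by simp only [hUdef, Set.mem_ofPred_eq]; linarith
  have hfU : ∀ w ∈ U, f w = ∑' n : ℕ, c n * cexp (2 * π * I * n * w) := fun w hw ↦
    (h w (by simp only [hUdef, Set.mem_ofPred_eq] at hw; linarith)).tsum_eq.symm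
  have hu : Summable fun n : ℕ ↦ ‖c n * cexp (2 * π * I * n * (I * (z.im / 2 : ℝ)))‖ :=
    (h (I * (z.im / 2 : ℝ)) (by simp only [I_mul_im, ofReal_re]; linarith)).summable.norm
  have hd : ∀ n : ℕ, ∀ w : ℂ, HasDerivAt (fun w ↦ c n * cexp (2 * π * I * n * w))
      ((2 * π * I * n * c n) * cexp (2 * π * I * n * w)) w := fun n w ↦ by
    refine (((hasDerivAt_id' w).const_mul (2 * π * I * n : ℂ)).cexp.const_mul (c n)).congr_deriv ?_
    ring
  have hb : ∀ (n : ℕ) (w : ℂ), w ∈ U → ‖c n * cexp (2 * π * I * n * w)‖ ≤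
      ‖c n * cexp (2 * π * I * n * (I * (z.im / 2 : ℝ)))‖ := fun n w hw ↦ by
    simp only [hUdef, Set.mem_ofPred_eq] at hw
    rw [norm_mul, norm_mul, Complex.norm_exp, Complex.norm_exp]
    refine mul_le_mul_of_nonneg_left (Real.exp_le_exp.mpr ?_) (norm_nonneg _)
    have e1 : (2 * π * I * n * w).re = -(2 * π * n * w.im) := by simp
    have e2 : (2 * π * I * n * (I * (z.im / 2 : ℝ))).re = -(2 * π * n * (z.im / 2)) := by simp
    rw [e1, e2]
    gcongr
  have heq : f =ᶠ[𝓝 z] fun w ↦ ∑' n : ℕ, c n * cexp (2 * π * I * n * w) := by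
    filter_upwards [hU.mem_nhds hzU] with w hw using hfU w hw
  have hdiff : DifferentiableOn ℂ (fun w ↦ ∑' n : ℕ, c n * cexp (2 * π * I * n * w)) U :=
    differentiableOn_tsum_of_summable_norm hu
      (fun n w _ ↦ (hd n w).differentiableAt.differentiableWithinAt) hU hb
  have hda := hdiff.differentiableAt (hU.mem_nhds hzU)
  refine ⟨(hda.congr_of_eventuallyEq heq).hasDerivAt, ?_⟩
  rw [heq.deriv_eq]
  simpa only [(hd _ z).deriv] using hasSum_deriv_of_summable_norm hu
      (fun n w _ ↦ (hd n w).differentiableAt.differentiableWithinAt) hU hb hzU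

lemma hasSum_eisensteinTwo {z : ℂ} (hz : 0 < z.im) :
    HasSum (fun n : ℕ ↦ (if n = 0 then 1 else -24 * ArithmeticFunction.sigma 1 n : ℂ) *
      cexp (2 * π * I * n * z)) (eisensteinTwo z) := by
  have := hasSum_qExpansion_E2 (z := ⟨z, hz⟩)
  rw [eisensteinTwo, ofComplex_apply_of_im_pos hz]
  refine this.congr_fun ?_ 
  intro n
  rw [smul_eq_mul, ← Complex.exp_nat_mul]
  simp
  ring_nf

lemma hasSum_eisensteinFour {z : ℂ} (hz : 0 < z.im) :
    HasSum (fun n : ℕ ↦ (if n = 0 then 1 else 240 * ArithmeticFunction.sigma 3 n : ℂ) *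
      cexp (2 * π * I * n * z)) (eisensteinFour z) := by
  have := ModularForm.hasSum_qExpansion (f := E₄) one_pos one_mem_strictPeriods_SL ⟨z, hz⟩
  rw [eisensteinFour, ofComplex_apply_of_im_pos hz]
  refine this.congr_fun ?_
  intro n
  rw [E_qExpansion_coeff _ ⟨2, rfl⟩, Function.Periodic.qParam, ← Complex.exp_nat_mul]
  have hb : bernoulli 4 = -1 / 30 := by
    rw [bernoulli_eq_bernoulli'_of_ne_one (by norm_num), bernoulli'_four]
  congr 1
  · split_ifs
    · rfl
    · rw [hb]; norm_num
  · congr 1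
    push_cast
    ring

lemma slash_S_eq (f : ℍ → ℂ) (k : ℤ) (z : ℍ) :
    (f ∣[k] ModularGroup.S) z = f (ModularGroup.S • z) * (z : ℂ) ^ (-k) := by
  rw [SlashInvariantForm.slash_S_apply, modular_S_smul]

lemma E2_S_smul (z : ℍ) :
    E2 (ModularGroup.S • z) = (z : ℂ) ^ 2 * E2 z + 6 / (π * I) * z := by
  have h := congrFun (E2_slash_action ModularGroup.S) z
  have hz := ne_zero z
  have hp : (π : ℂ) ≠ 0 := by exact_mod_cast Real.pi_ne_zero
  simp only [slash_S_eq, Pi.sub_apply, Pi.smul_apply, D2_S, riemannZeta_two, smul_eq_mul,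
    zpow_neg] at h
  have hz2 : (z : ℂ) ^ (2 : ℤ) = (z : ℂ) ^ 2 := by norm_cast
  rw [hz2] at h
  field_simp at h ⊢
  linear_combination I * h - 6 * z * I_sq

lemma neg_inv_eq_coe_S_smul (z : ℍ) : -(z : ℂ)⁻¹ = (ModularGroup.S • z : ℍ) := by
  rw [modular_S_smul]; simp

lemma neg_inv_im_pos {z : ℂ} (hz : 0 < z.im) : 0 < (-z⁻¹).im := by
  have h := neg_inv_eq_coe_S_smul ⟨z, hz⟩
  rw [coe_mk] at h
  rw [h]
  exact im_pos _

lemma eisensteinTwo_neg_inv {z : ℂ} (hz : 0 < z.im) :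
    eisensteinTwo (-z⁻¹) = z ^ 2 * eisensteinTwo z + 6 / (π * I) * z := by
  have h := E2_S_smul ⟨z, hz⟩
  have h2 := neg_inv_eq_coe_S_smul ⟨z, hz⟩
  rw [coe_mk] at h2
  rw [eisensteinTwo, eisensteinTwo, h2, ofComplex_apply, ofComplex_apply_of_im_pos hz, h]

lemma eisensteinFour_neg_inv {z : ℂ} (hz : 0 < z.im) :
    eisensteinFour (-z⁻¹) = z ^ 4 * eisensteinFour z := by
  have h : (E₄ : ℍ → ℂ) ∣[(4 : ℤ)] ModularGroup.S = E₄ :=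
    SlashInvariantForm.slash_action_eqn E₄ _ ⟨ModularGroup.S, rfl⟩
  replace h := congrFun h ⟨z, hz⟩
  have h2 := neg_inv_eq_coe_S_smul ⟨z, hz⟩
  have hz0 : z ≠ 0 := by rintro rfl; simp at hz
  rw [coe_mk] at h2
  rw [eisensteinFour, eisensteinFour, h2, ofComplex_apply, ofComplex_apply_of_im_pos hz, ← h,
    slash_S_eq, coe_mk, zpow_neg]
  norm_cast
  field_simp

lemma cexp_two_pi_mul_add_one (n : ℕ) (z : ℂ) :
    cexp (2 * π * I * n * (z + 1)) = cexp (2 * π * I * n * z) := by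
  rw [mul_add, Complex.exp_add, mul_one, mul_comm (2 * π * I) (n : ℂ), exp_nat_mul_two_pi_mul_I,
    mul_one]

lemma eisensteinTwo_add_one {z : ℂ} (hz : 0 < z.im) :
    eisensteinTwo (z + 1) = eisensteinTwo z := by
  have h := hasSum_eisensteinTwo (z := z + 1) (by simpa using hz)
  simp only [cexp_two_pi_mul_add_one] at h
  exact h.unique (hasSum_eisensteinTwo hz)

lemma eisensteinFour_add_one {z : ℂ} (hz : 0 < z.im) :
    eisensteinFour (z + 1) = eisensteinFour z := by
  have h := hasSum_eisensteinFour (z := z + 1) (by simpa using hz)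
  simp only [cexp_two_pi_mul_add_one] at h
  exact h.unique (hasSum_eisensteinFour hz)

lemma hasDerivAt_eisensteinTwo {z : ℂ} (hz : 0 < z.im) :
    HasDerivAt eisensteinTwo (2 * π * I * (D E2) ⟨z, hz⟩) z := by
  have := (hasSum_deriv_of_hasSum_cexp (fun _ h ↦ hasSum_eisensteinTwo h) hz).1
  refine this.congr_deriv ?_
  rw [normalizedDerivOfComplex, mul_inv_cancel_left₀ two_pi_I_ne_zero]
  rfl

lemma hasSum_D_E2 (z : ℍ) :
    HasSum (fun n : ℕ ↦ ((n : ℂ) * (if n = 0 then 1 else -24 * ArithmeticFunction.sigma 1 n : ℂ)) *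
      cexp (2 * π * I * n * z)) ((D E2) z) := by
  have := (hasSum_deriv_of_hasSum_cexp (fun _ h ↦ hasSum_eisensteinTwo h) z.im_pos).2
  refine (this.mul_left (2 * π * I : ℂ)⁻¹).congr_fun fun n ↦ ?_
  have := two_pi_I_ne_zero
  field_simp

lemma D_E2_S_smul (z : ℍ) :
    (D E2) (ModularGroup.S • z) = (z : ℂ) ^ 4 * (D E2) z + (z : ℂ) ^ 3 * E2 z / (π * I)
      - 3 * (z : ℂ) ^ 2 / π ^ 2 := by
  have hz := ne_zero z
  have h1 : HasDerivAt (fun w : ℂ ↦ eisensteinTwo (-w⁻¹))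
      (2 * π * I * (D E2) (ModularGroup.S • z) * ((z : ℂ) ^ 2)⁻¹) z := by
    have h2 := hasDerivAt_eisensteinTwo (neg_inv_im_pos z.im_pos)
    have h3 : HasDerivAt (fun w : ℂ ↦ -w⁻¹) (((z : ℂ) ^ 2)⁻¹) z := by
      exact (hasDerivAt_inv hz).neg.congr_deriv (by simp)
    refine (h2.comp (z : ℂ) h3).congr_deriv ?_
    congr 3
    exact UpperHalfPlane.ext (neg_inv_eq_coe_S_smul z)
  have h4 : HasDerivAt (fun w : ℂ ↦ w ^ 2 * eisensteinTwo w + 6 / (π * I) * w)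
      (2 * z * E2 z + z ^ 2 * (2 * π * I * (D E2) z) + 6 / (π * I)) z := by
    have h5 := hasDerivAt_eisensteinTwo z.im_pos
    have h6 := ((hasDerivAt_pow 2 (z : ℂ)).mul h5).add
      ((hasDerivAt_id' (z : ℂ)).const_mul (6 / (π * I) : ℂ))
    refine h6.congr_deriv ?_
    simp [eisensteinTwo]
  have h7 := (h1.congr_of_eventuallyEq (f₁ := fun w : ℂ ↦ w ^ 2 * eisensteinTwo w + 6 / (π * I) * w)
    (by filter_upwards [isOpen_upperHalfPlaneSet.mem_nhds z.im_pos] with w hw using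
      (eisensteinTwo_neg_inv hw).symm)).unique h4
  have hp : (π : ℂ) ≠ 0 := by exact_mod_cast Real.pi_ne_zero
  field_simp at h7 ⊢
  refine mul_left_cancel₀ I_ne_zero ?_
  linear_combination h7 / 2 + 3 * z ^ 2 * I_sq

lemma D_E2_T_smul (z : ℍ) : (D E2) (ModularGroup.T • z) = (D E2) z := by
  have h := hasSum_D_E2 (ModularGroup.T • z)
  have h2 : ((ModularGroup.T • z : ℍ) : ℂ) = z + 1 := by rw [modular_T_smul]; simp [add_comm]
  simp only [h2, cexp_two_pi_mul_add_one] at h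
  exact h.unique (hasSum_D_E2 z)

lemma E2_T_smul (z : ℍ) : E2 (ModularGroup.T • z) = E2 z := by
  have h := eisensteinTwo_add_one z.im_pos
  have h2 : ((ModularGroup.T • z : ℍ) : ℂ) = z + 1 := by rw [modular_T_smul]; simp [add_comm]
  rwa [eisensteinTwo, eisensteinTwo, ← h2, ofComplex_apply, ofComplex_apply] at h

lemma tendsto_atImInfty_of_hasSum_cexp {f : ℍ → ℂ} {c : ℕ → ℂ}
    (h : ∀ z : ℍ, HasSum (fun n : ℕ ↦ c n * cexp (2 * π * I * n * z)) (f z)) :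
    Tendsto f atImInfty (𝓝 (c 0)) := by
  set q : ℍ → ℂ := fun τ ↦ Function.Periodic.qParam 1 τ with hq
  have hf : ∀ τ : ℍ, HasSum (fun m ↦ c m * q τ ^ m) (f τ) := fun τ ↦ by
    refine (h τ).congr_fun fun n ↦ ?_
    simp only [hq, Function.Periodic.qParam, ← Complex.exp_nat_mul]
    congr 2
    push_cast
    ring
  have hg : ∀ τ : ℍ, HasSum (fun m ↦ c (m + 1) • Function.Periodic.qParam 1 τ ^ m)
      ((q τ)⁻¹ * (f τ - c 0)) := fun τ ↦ by
    have h1 := (hasSum_nat_add_iff' 1).2 (hf τ)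
    refine ((by simpa using h1.mul_left (q τ)⁻¹ : HasSum _ _).congr_fun fun n ↦ ?_)
    have h0 : q τ ≠ 0 := Complex.exp_ne_zero _
    rw [smul_eq_mul, show Function.Periodic.qParam 1 (τ : ℂ) = q τ from rfl]
    field_simp
    ring
  have hb : (fun τ ↦ (q τ)⁻¹ * (f τ - c 0)) =O[atImInfty] (fun _ ↦ (1 : ℝ)) :=
    isBoundedAtImInfty_of_hasSum_qExpansion one_pos hg
  have hq0 : Tendsto q atImInfty (𝓝 0) := qParam_tendsto_atImInfty one_pos
  have hlim : Tendsto (fun τ ↦ q τ * ((q τ)⁻¹ * (f τ - c 0)) + c 0) atImInfty (𝓝 (0 + c 0)) := by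
    refine Tendsto.add_const _ ?_
    exact hq0.zero_mul_isBoundedUnder_le (hb.isBoundedUnder_le)
  rw [zero_add] at hlim
  refine hlim.congr fun τ ↦ ?_
  have h0 : q τ ≠ 0 := Complex.exp_ne_zero _
  field_simp
  ring

lemma tendsto_ramanujan : Tendsto (E2 ^ 2 - (12 : ℂ) • D E2) atImInfty (𝓝 1) := by
  have h1 : Tendsto E2 atImInfty (𝓝 1) := by
    refine tendsto_atImInfty_of_hasSum_cexp (c := fun n ↦
      if n = 0 then 1 else -24 * ArithmeticFunction.sigma 1 n) fun z ↦ ?_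
    simpa [eisensteinTwo] using hasSum_eisensteinTwo z.im_pos
  have h2 : Tendsto (D E2) atImInfty (𝓝 0) := by
    simpa using tendsto_atImInfty_of_hasSum_cexp hasSum_D_E2
  simpa [Pi.sub_def, Pi.pow_def, Pi.smul_def] using (h1.pow 2).sub (h2.const_mul 12)

lemma tendsto_E₄ : Tendsto E₄ atImInfty (𝓝 1) := by
  refine tendsto_atImInfty_of_hasSum_cexp (c := fun n ↦
    if n = 0 then 1 else 240 * ArithmeticFunction.sigma 3 n) fun z ↦ ?_
  simpa [eisensteinFour] using hasSum_eisensteinFour z.im_pos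

lemma slash_ramanujan (γ : SL(2, ℤ)) :
    (E2 ^ 2 - (12 : ℂ) • D E2) ∣[(4 : ℤ)] γ = E2 ^ 2 - (12 : ℂ) • D E2 := by
  refine SlashInvariantForm.slash_action_generators_SL2Z ?_ ?_ γ
  · ext z
    have hz := ne_zero z
    have hp : (π : ℂ) ≠ 0 := by exact_mod_cast Real.pi_ne_zero
    rw [slash_S_eq]
    simp only [Pi.sub_apply, Pi.smul_apply, Pi.pow_apply, smul_eq_mul, E2_S_smul, D_E2_S_smul,
      zpow_neg]
    rw [show (z : ℂ) ^ (4 : ℤ) = (z : ℂ) ^ 4 by norm_cast]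
    field_simp
    linear_combination (36 : ℂ) * I_sq
  · ext z
    rw [SL_slash_apply]
    have h : denom ModularGroup.T z = 1 := by
      rw [ModularGroup.denom_apply]; simp [ModularGroup.T]
    rw [h, one_zpow, mul_one]
    change E2 (ModularGroup.T • z) ^ 2 - 12 * (D E2) (ModularGroup.T • z) = _
    rw [E2_T_smul, D_E2_T_smul]
    rfl

/-- The weight four level one modular form `E₂ ^ 2 - 12 D E₂`. -/
noncomputable def ramanujanForm : ModularForm 𝒮ℒ 4 where
  toFun := E2 ^ 2 - (12 : ℂ) • D E2
  slash_action_eq' A hA := by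
    obtain ⟨A, rfl⟩ := hA
    exact slash_ramanujan A
  holo' := by
    have h1 := E2_mdifferentiable
    have h2 := normalizedDerivOfComplex_mdifferentiable E2_mdifferentiable
    exact (h1.pow 2).sub (h2.const_smul 12)
  bdd_at_cusps' hc := by
    rw [Subgroup.IsArithmetic.isCusp_iff_isCusp_SL2Z] at hc
    rw [OnePoint.isBoundedAt_iff_forall_SL2Z hc]
    intro γ _
    rw [slash_ramanujan]
    exact tendsto_ramanujan.isBigO_one ℝ

lemma ramanujanForm_eq : ramanujanForm = E₄ := by
  obtain ⟨c, hc⟩ := (finrank_eq_one_iff_of_nonzero' E₄ (E_ne_zero _ ⟨2, rfl⟩)).1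
    (Module.rank_eq_one_iff_finrank_eq_one.1 levelOne_weight_four_rank_one) ramanujanForm
  have h1 : Tendsto (c • E₄ : ModularForm 𝒮ℒ 4) atImInfty (𝓝 (c * 1)) :=
    tendsto_E₄.const_mul c
  rw [hc] at h1
  have h2 := tendsto_nhds_unique h1 tendsto_ramanujan
  rw [← hc, ← mul_one c, h2, one_smul]

lemma hasDerivAt_eisensteinTwo_eq {z : ℂ} (hz : 0 < z.im) :
    HasDerivAt eisensteinTwo (π * I / 6 * (eisensteinTwo z ^ 2 - eisensteinFour z)) z := by
  have h : ramanujanForm ⟨z, hz⟩ = E₄ ⟨z, hz⟩ := by rw [ramanujanForm_eq]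
  replace h : E2 ⟨z, hz⟩ ^ 2 - 12 * (D E2) ⟨z, hz⟩ = E₄ ⟨z, hz⟩ := h
  refine (hasDerivAt_eisensteinTwo hz).congr_deriv ?_
  rw [eisensteinTwo, eisensteinFour, ofComplex_apply_of_im_pos hz, ← h]
  ring

/-- The lattice `ℤ z + ℤ`. -/
noncomputable def upperPeriodPair (z : ℂ) (hz : 0 < z.im) : PeriodPair where
  ω₁ := z
  ω₂ := 1
  indep := by
    refine LinearIndependent.pair_iff.2 fun s t h ↦ ?_
    have him := congrArg Complex.im h
    have hre := congrArg Complex.re h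
    simp at him hre
    rcases him with hs | hs
    · exact ⟨hs, by simpa [hs] using hre⟩
    · exact absurd hs hz.ne'

lemma hasSum_lattice_iff {z : ℂ} (hz : 0 < z.im) {f : ℂ → ℂ} {a : ℂ} :
    HasSum (fun l : (upperPeriodPair z hz).lattice ↦ f l) a ↔
      HasSum (fun p : ℤ × ℤ ↦ f (p.1 * z + p.2)) a := by
  rw [← (upperPeriodPair z hz).latticeEquivProd.symm.toEquiv.hasSum_iff]
  refine Eq.to_iff (congrArg (HasSum · a _) (funext fun p ↦ ?_))
  have := (upperPeriodPair z hz).latticeEquiv_symm_apply p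
  simp only [upperPeriodPair, mul_one] at this
  simp only [Function.comp_apply, ← this]
  rfl

lemma one_div_two_notMem_lattice {z : ℂ} (hz : 0 < z.im) :
    (1 / 2 : ℂ) ∉ (upperPeriodPair z hz).lattice :=
  (upperPeriodPair z hz).ω₂_div_two_notMem_lattice

lemma G_four_upperPeriodPair {z : ℂ} (hz : 0 < z.im) :
    (upperPeriodPair z hz).G 4 = π ^ 4 / 45 * eisensteinFour z := by
  have h1 : HasSum (fun p : ℤ × ℤ ↦ ((p.1 * z + p.2) ^ 4)⁻¹)
      (∑' v : Fin 2 → ℤ, eisSummand (4 : ℕ) v ⟨z, hz⟩) := by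
    have h := ((summable_norm_eisSummand (k := (4 : ℕ)) (by norm_num) ⟨z, hz⟩).of_norm).hasSum
    rw [← (finTwoArrowEquiv ℤ).symm.hasSum_iff] at h
    refine h.congr_fun fun p ↦ ?_
    simp [eisSummand, finTwoArrowEquiv]
  have h2 := (hasSum_lattice_iff hz (f := fun l ↦ (l ^ 4)⁻¹)).2 h1
  rw [PeriodPair.G, h2.tsum_eq, tsum_eisSummand_eq_riemannZeta_mul_eisensteinSeries (by norm_num)]
  have h4 : eisensteinFour z = 1 / 2 * eisensteinSeries (N := 1) 0 (4 : ℕ) ⟨z, hz⟩ := by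
    rw [eisensteinFour, ofComplex_apply_of_im_pos hz]
    rfl
  rw [h4, Nat.cast_ofNat, riemannZeta_four]
  ring

/-- Splitting a sum over `ℤ` into its even and odd parts. -/
lemma hasSum_int_odd {α : Type*} {f : α × ℤ → ℂ} {a b : ℂ} (h : HasSum f a)
    (he : HasSum (fun p : α × ℤ ↦ f (p.1, 2 * p.2)) b) :
    HasSum (fun p : α × ℤ ↦ f (p.1, 2 * p.2 - 1)) (a - b) := by
  have hi : Function.Injective (fun p : α × ℤ ↦ (p.1, 2 * p.2)) := by
    rintro ⟨p, m⟩ ⟨q, n⟩ h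
    simp at h
    simp [h]
  have hj : Function.Injective (fun p : α × ℤ ↦ (p.1, 2 * p.2 - 1)) := by
    rintro ⟨p, m⟩ ⟨q, n⟩ h
    simp at h
    simp [h]
  have hs : Summable (fun p : α × ℤ ↦ f (p.1, 2 * p.2 - 1)) := h.summable.comp_injective hj
  have hc : IsCompl (Set.range fun p : α × ℤ ↦ (p.1, 2 * p.2))
      (Set.range fun p : α × ℤ ↦ (p.1, 2 * p.2 - 1)) := by
    refine ⟨Set.disjoint_left.2 ?_, codisjoint_iff_le_sup.2 ?_⟩
    · rintro _ ⟨p, rfl⟩ ⟨q, hq⟩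
      simp at hq
      lia
    · rintro ⟨p, m⟩ -
      rcases Int.even_or_odd' m with ⟨k, rfl | rfl⟩
      · exact Or.inl ⟨(p, k), rfl⟩
      · exact Or.inr ⟨(p, k + 1), by simp; ring⟩
  have := HasSum.add_isCompl hc (hi.hasSum_range_iff.2 he) (hj.hasSum_range_iff.2 hs.hasSum)
  rw [← this.unique h, add_sub_cancel_left]
  exact hs.hasSum

lemma two_mul_im_pos {z : ℂ} (hz : 0 < z.im) : 0 < (2 * z).im := by
  simpa using hz

lemma hasSum_upperPeriodPair_inv_pow_four {z : ℂ} (hz : 0 < z.im) :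
    HasSum (fun p : ℤ × ℤ ↦ ((p.1 * z + p.2) ^ 4)⁻¹) ((upperPeriodPair z hz).G 4) := by
  refine (hasSum_lattice_iff hz (f := fun l ↦ (l ^ 4)⁻¹)).1 ?_
  rw [← PeriodPair.sumInvPow_zero]
  simpa using (upperPeriodPair z hz).hasSum_sumInvPow 0 (r := 4) (by norm_num)

lemma sumInvPow_one_div_two {z : ℂ} (hz : 0 < z.im) :
    (upperPeriodPair z hz).sumInvPow (1 / 2) 4 =
      16 * (upperPeriodPair (2 * z) (two_mul_im_pos hz)).G 4 - (upperPeriodPair z hz).G 4 := by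
  have h1 := (upperPeriodPair z hz).hasSum_sumInvPow (1 / 2) (r := 4) (by norm_num)
  rw [hasSum_lattice_iff hz (f := fun l ↦ ((l - 1 / 2) ^ 4)⁻¹)] at h1
  have h2 := hasSum_upperPeriodPair_inv_pow_four (two_mul_im_pos hz)
  have h3 := hasSum_int_odd h2 (b := (upperPeriodPair z hz).G 4 / 16)
    (((hasSum_upperPeriodPair_inv_pow_four hz).div_const 16).congr_fun fun p ↦ by
      push_cast
      rw [show (p.1 * (2 * z) + 2 * p.2 : ℂ) = 2 * (p.1 * z + p.2) by ring, mul_pow, mul_inv]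
      norm_num
      ring)
  rw [h1.unique ((h3.mul_left 16).congr_fun fun p ↦ ?_)]
  · ring
  · push_cast
    rw [show (p.1 * (2 * z) + (2 * p.2 - 1) : ℂ) = 2 * (p.1 * z + p.2 - 1 / 2) by ring, mul_pow,
      mul_inv]
    norm_num
    ring

/-- The sum of `(d + m z)⁻²` over `d`, for `m` fixed. -/
lemma hasSum_e2Summand {z : ℂ} (hz : 0 < z.im) (m : ℤ) :
    HasSum (fun n : ℤ ↦ ((m * z + n) ^ 2)⁻¹) (e2Summand m ⟨z, hz⟩) := by
  refine (e2Summand_summable m ⟨z, hz⟩).hasSum.congr_fun fun n ↦ ?_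
  simp [eisSummand]

lemma hasSum_e2Summand_eisensteinTwo {z : ℂ} (hz : 0 < z.im) :
    HasSum (e2Summand · ⟨z, hz⟩) (π ^ 2 / 3 * eisensteinTwo z) (SummationFilter.symmetricIcc ℤ) := by
  have h : HasSum (e2Summand · ⟨z, hz⟩) (G2 ⟨z, hz⟩) (SummationFilter.symmetricIcc ℤ) :=
    (summable_e2Summand_symmetricIcc ⟨z, hz⟩).hasSum
  convert! h using 1
  rw [eisensteinTwo, ofComplex_apply_of_im_pos hz, E2]
  simp only [Pi.smul_apply, smul_eq_mul, riemannZeta_two]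
  have : (π : ℂ) ≠ 0 := by simp
  field_simp
  ring

lemma weierstrassP_one_div_two {z : ℂ} (hz : 0 < z.im) :
    ℘[upperPeriodPair z hz] (1 / 2) =
      2 * π ^ 2 / 3 * (2 * eisensteinTwo (2 * z) - eisensteinTwo z) := by
  have h1 := (upperPeriodPair z hz).hasSum_weierstrassP (1 / 2)
  rw [hasSum_lattice_iff hz (f := fun l ↦ 1 / (1 / 2 - l) ^ 2 - 1 / l ^ 2)] at h1
  have h2 (m : ℤ) : HasSum (fun n : ℤ ↦ 1 / (1 / 2 - (m * z + n)) ^ 2 - 1 / (m * z + n) ^ 2)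
      (4 * e2Summand m ⟨2 * z, two_mul_im_pos hz⟩ - 2 * e2Summand m ⟨z, hz⟩) := by
    have h3 := hasSum_e2Summand hz m
    have h4 := hasSum_e2Summand (two_mul_im_pos hz) m
    have h3' : HasSum (fun p : Unit × ℤ ↦ ((m * z + p.2) ^ 2)⁻¹) (e2Summand m ⟨z, hz⟩) :=
      ((Equiv.punitProd ℤ).hasSum_iff (f := fun n : ℤ ↦ ((m * z + n : ℂ) ^ 2)⁻¹)).2 h3
    have h4' : HasSum (fun p : Unit × ℤ ↦ ((m * (2 * z) + p.2) ^ 2)⁻¹)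
        (e2Summand m ⟨2 * z, two_mul_im_pos hz⟩) :=
      ((Equiv.punitProd ℤ).hasSum_iff (f := fun n : ℤ ↦ ((m * (2 * z) + n : ℂ) ^ 2)⁻¹)).2 h4
    have h5 := hasSum_int_odd h4' (b := e2Summand m ⟨z, hz⟩ / 4)
      ((h3'.div_const 4).congr_fun fun p ↦ by
        push_cast
        rw [show (m * (2 * z) + 2 * p.2 : ℂ) = 2 * (m * z + p.2) by ring, mul_pow, mul_inv]
        norm_num
        ring)
    have h6 := (Equiv.punitProd ℤ).symm.hasSum_iff.2 ((h5.mul_left 4).sub h3')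
    convert! h6 using 1
    · funext n
      simp only [Function.comp_apply, Equiv.punitProd_symm_apply]
      push_cast
      rw [show (m * (2 * z) + (2 * n - 1) : ℂ) = -2 * (1 / 2 - (m * z + n)) by ring, mul_pow,
        mul_inv]
      norm_num
      ring
    · ring
  have h3 : HasSum (fun m ↦ 4 * e2Summand m ⟨2 * z, two_mul_im_pos hz⟩ - 2 * e2Summand m ⟨z, hz⟩)
      (℘[upperPeriodPair z hz] (1 / 2)) (SummationFilter.symmetricIcc ℤ) :=
    (HasSum.prod_fiberwise h1 h2).mono_left SummationFilter.LeAtTop.le_atTop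
  rw [h3.unique (((hasSum_e2Summand_eisensteinTwo (two_mul_im_pos hz)).mul_left 4).sub
    ((hasSum_e2Summand_eisensteinTwo hz).mul_left 2))]
  ring

namespace PeriodPair

lemma isPreconnected_compl_lattice (L : PeriodPair) : IsPreconnected (L.lattice : Set ℂ)ᶜ :=
  (Set.Countable.isConnected_compl_of_one_lt_rank (by simp)
    (countable_of_Lindelof_of_discrete (X := L.lattice))).2

lemma tendsto_weierstrassP_cobounded (L : PeriodPair) :
    Tendsto ℘[L] (𝓝[≠] 0) (Bornology.cobounded ℂ) :=
  tendsto_cobounded_of_meromorphicOrderAt_neg (by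
    rw [L.order_weierstrassP 0 (zero_mem _)]
    decide)

lemma exists_derivWeierstrassP_ne_zero (L : PeriodPair) :
    ∃ z ∉ L.lattice, ℘'[L] z ≠ 0 := by
  by_contra! h
  obtain ⟨c, hc⟩ := L.isClosed_lattice.isOpen_compl.exists_is_const_of_deriv_eq_zero
    L.isPreconnected_compl_lattice L.differentiableOn_weierstrassP
    (fun z hz ↦ by rw [deriv_weierstrassP]; exact h z hz)
  have h1 : ∀ᶠ z in 𝓝[≠] (0 : ℂ), ℘[L] z = c := by
    filter_upwards [self_mem_nhdsWithin, mem_nhdsWithin_of_mem_nhds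
      ((L.isOpen_compl_lattice_sdiff (s := {0})).mem_nhds (by simp : (0 : ℂ) ∈ _))] with z hz hz'
    exact hc z fun h ↦ hz' ⟨h, hz⟩
  have h2 := L.tendsto_weierstrassP_cobounded.congr' h1
  rw [← tendsto_norm_atTop_iff_cobounded] at h2
  exact not_tendsto_nhds_of_tendsto_atTop h2 _ tendsto_const_nhds

lemma deriv_derivWeierstrassP (L : PeriodPair) {z : ℂ} (hz : z ∉ L.lattice) :
    deriv ℘'[L] z = 6 * ℘[L] z ^ 2 - L.g₂ / 2 := by
  have hU := L.isClosed_lattice.isOpen_compl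
  have h1 := L.analyticOnNhd_derivWeierstrassP
  have h2 := L.analyticOnNhd_weierstrassP
  have h3 : AnalyticOnNhd ℂ (fun z ↦ 2 * deriv ℘'[L] z - 12 * ℘[L] z ^ 2 + L.g₂)
      (L.lattice : Set ℂ)ᶜ := by
    intro w hw
    have := h1.deriv w hw
    have := h2 w hw
    fun_prop
  have hfg : ∀ w ∈ (L.lattice : Set ℂ)ᶜ,
      ℘'[L] w * (2 * deriv ℘'[L] w - 12 * ℘[L] w ^ 2 + L.g₂) = 0 := by
    intro w hw
    have hd1 := (h1 w hw).differentiableAt.hasDerivAt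
    have hd2 := (h2 w hw).differentiableAt.hasDerivAt
    rw [deriv_weierstrassP] at hd2
    have e2 := (((hd2.pow 3).const_mul 4).sub (hd2.const_mul L.g₂)).sub_const L.g₃
    have e3 := (hd1.pow 2).unique (e2.congr_of_eventuallyEq (eventuallyEq_iff_exists_mem.2
      ⟨_, hU.mem_nhds hw, fun x hx ↦ L.derivWeierstrassP_sq x hx⟩))
    simp at e3
    linear_combination e3
  rcases h1.eq_zero_or_eq_zero_of_mul_eq_zero h3 hfg L.isPreconnected_compl_lattice with h | h
  · obtain ⟨w, hw, hw'⟩ := L.exists_derivWeierstrassP_ne_zero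
    exact absurd (h w hw) hw'
  · linear_combination (h z hz) / 2

lemma six_mul_sumInvPow_four (L : PeriodPair) {z : ℂ} (hz : z ∉ L.lattice) :
    6 * L.sumInvPow z 4 = 6 * ℘[L] z ^ 2 - L.g₂ / 2 := by
  rw [← L.deriv_derivWeierstrassPExcept_self, L.derivWeierstrassPExcept_of_notMem z hz,
    L.deriv_derivWeierstrassP hz]

end PeriodPair

lemma five_mul_sq_eisensteinTwo {z : ℂ} (hz : 0 < z.im) :
    5 * (2 * eisensteinTwo (2 * z) - eisensteinTwo z) ^ 2 =
      eisensteinFour z + 4 * eisensteinFour (2 * z) := by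
  have h := (upperPeriodPair z hz).six_mul_sumInvPow_four (one_div_two_notMem_lattice hz)
  rw [sumInvPow_one_div_two, PeriodPair.g₂, weierstrassP_one_div_two, G_four_upperPeriodPair,
    G_four_upperPeriodPair] at h
  have hπ : (π : ℂ) ≠ 0 := by simp
  have : (π : ℂ) ^ 4 * (5 * (2 * eisensteinTwo (2 * z) - eisensteinTwo z) ^ 2) =
      π ^ 4 * (eisensteinFour z + 4 * eisensteinFour (2 * z)) := by
    linear_combination (-15/8) * h
  exact mul_left_cancel₀ (pow_ne_zero 4 hπ) this

/-- A weight two modular form of level two: `E₂(z / 2) / 2 - E₂(z)`. -/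
noncomputable def eisensteinTwoLevelTwo (z : ℂ) : ℂ := eisensteinTwo (z / 2) / 2 - eisensteinTwo z

lemma div_two_im_pos {z : ℂ} (hz : 0 < z.im) : 0 < (z / 2).im := by
  simpa using hz

lemma add_one_im_pos {z : ℂ} (hz : 0 < z.im) : 0 < (z + 1).im := by
  simpa using hz

lemma hasDerivAt_eisensteinTwoLevelTwo {z : ℂ} (hz : 0 < z.im) :
    HasDerivAt eisensteinTwoLevelTwo (π * I / 3 * (eisensteinTwo z * eisensteinTwoLevelTwo z -
      2 * eisensteinTwoLevelTwo z ^ 2 + eisensteinFour z)) z := by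
  have h1 := (hasDerivAt_eisensteinTwo_eq (div_two_im_pos hz)).comp z ((hasDerivAt_id' z).div_const 2)
  have h2 := five_mul_sq_eisensteinTwo (div_two_im_pos hz)
  rw [mul_div_cancel₀ z two_ne_zero] at h2
  refine ((h1.div_const 2).sub (hasDerivAt_eisensteinTwo_eq hz)).congr_deriv ?_
  rw [eisensteinTwoLevelTwo]
  linear_combination π * I / 24 * h2

lemma hasDerivAt_eisensteinTwoLevelTwo_add_one {z : ℂ} (hz : 0 < z.im) :
    HasDerivAt (fun z ↦ eisensteinTwoLevelTwo (z + 1)) (π * I / 3 *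
      (eisensteinTwo z * eisensteinTwoLevelTwo (z + 1) - 2 * eisensteinTwoLevelTwo (z + 1) ^ 2 +
        eisensteinFour z)) z := by
  have h := (hasDerivAt_eisensteinTwoLevelTwo (add_one_im_pos hz)).comp z
    ((hasDerivAt_id' z).add_const 1)
  rw [eisensteinTwo_add_one hz, eisensteinFour_add_one hz] at h
  exact h.congr_deriv (mul_one _)

lemma deriv_deriv_eisensteinTwo_sub {z : ℂ} (hz : 0 < z.im)
    (h0 : eisensteinTwoLevelTwo z + eisensteinTwoLevelTwo (z + 1) = 0) :
    deriv (deriv eisensteinTwo) (z / 2) - deriv (deriv eisensteinTwo) ((z + 1) / 2) =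
      -8 / 9 * π ^ 2 * eisensteinTwoLevelTwo z *
        (3 * eisensteinTwo z ^ 2 - 9 * eisensteinFour z + 16 * eisensteinTwoLevelTwo z ^ 2) := by
  have hd {w : ℂ} (hw : 0 < w.im) :=
    (hasSum_deriv_of_hasSum_cexp (fun _ ↦ hasSum_eisensteinTwo) hw).1
  have hdd {w : ℂ} (hw : 0 < w.im) :=
    (hasSum_deriv_of_hasSum_cexp
      (fun _ hw ↦ (hasSum_deriv_of_hasSum_cexp (fun _ ↦ hasSum_eisensteinTwo) hw).2) hw).1
  have h1 {w : ℂ} (hw : 0 < w.im) : (deriv eisensteinTwo (w / 2) -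
      deriv eisensteinTwo ((w + 1) / 2)) / 4 = π * I / 3 *
        ((eisensteinTwoLevelTwo w - eisensteinTwoLevelTwo (w + 1)) * (eisensteinTwo w -
          2 * (eisensteinTwoLevelTwo w + eisensteinTwoLevelTwo (w + 1)))) := by
    have e1 := ((hd (div_two_im_pos hw)).comp w ((hasDerivAt_id' w).div_const 2)).div_const 2
    have e2 := ((hd (div_two_im_pos (add_one_im_pos hw))).comp w
      (((hasDerivAt_id' w).add_const 1).div_const 2)).div_const 2
    have e3 := (hasDerivAt_eisensteinTwoLevelTwo hw).sub
      (hasDerivAt_eisensteinTwoLevelTwo_add_one hw)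
    have e4 := (e1.sub e2).unique (e3.congr_of_eventuallyEq (by
      filter_upwards [(isOpen_lt continuous_const Complex.continuous_im).mem_nhds hw] with x hx
      simp [eisensteinTwoLevelTwo, eisensteinTwo_add_one hx]))
    linear_combination e4
  have e1 := (hdd (div_two_im_pos hz)).comp z ((hasDerivAt_id' z).div_const 2)
  have e2 := (hdd (div_two_im_pos (add_one_im_pos hz))).comp z
    (((hasDerivAt_id' z).add_const 1).div_const 2)
  have a1 := hasDerivAt_eisensteinTwoLevelTwo hz
  have a2 := hasDerivAt_eisensteinTwoLevelTwo_add_one hz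
  have e3 := ((a1.sub a2).mul ((hasDerivAt_eisensteinTwo_eq hz).sub
    ((a1.add a2).const_mul 2))).const_mul (π * I / 3)
  have e4 := ((e1.sub e2).div_const 4).unique (e3.congr_of_eventuallyEq (by
      filter_upwards [(isOpen_lt continuous_const Complex.continuous_im).mem_nhds hz] with x hx
      exact h1 hx))
  have h2 : eisensteinTwoLevelTwo (z + 1) = -eisensteinTwoLevelTwo z := by linear_combination h0
  simp only [h2] at e4
  simp only [Pi.add_apply, Pi.sub_apply, h2] at e4
  linear_combination (exp := 1) 8 * e4 + (8 / 9 * π ^ 2 * eisensteinTwoLevelTwo z *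
        (3 * eisensteinTwo z ^ 2 - 9 * eisensteinFour z + 16 * eisensteinTwoLevelTwo z ^ 2)) * I_sq

lemma eisensteinTwo_I : eisensteinTwo I = 3 / π := by
  have h := eisensteinTwo_neg_inv (z := I) (by simp)
  have hπ : (π : ℂ) ≠ 0 := by simp
  rw [inv_I, neg_neg, I_sq] at h
  field_simp at h ⊢
  linear_combination h / 2

lemma neg_inv_I_sub_one : -(I - 1)⁻¹ = (1 + I) / 2 := by
  apply Complex.ext <;> simp [Complex.inv_re, Complex.inv_im, Complex.normSq_apply] <;> norm_num

lemma eisensteinTwo_one_add_I_div_two : eisensteinTwo ((1 + I) / 2) = 6 / π := by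
  have hπ : (π : ℂ) ≠ 0 := by simp
  have h := eisensteinTwo_neg_inv (z := I - 1) (by simp)
  have h2 := eisensteinTwo_add_one (z := I - 1) (by simp)
  rw [sub_add_cancel, eisensteinTwo_I] at h2
  rw [neg_inv_I_sub_one, ← h2] at h
  rw [h]
  field_simp
  linear_combination 3 * (I - 2) * I_sq

lemma eisensteinFour_one_add_I_div_two :
    eisensteinFour ((1 + I) / 2) = -4 * eisensteinFour I := by
  have h := eisensteinFour_neg_inv (z := I - 1) (by simp)
  have h2 := eisensteinFour_add_one (z := I - 1) (by simp)
  rw [sub_add_cancel] at h2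
  rw [neg_inv_I_sub_one, ← h2] at h
  rw [h]
  linear_combination (I ^ 2 - 4 * I + 5) * eisensteinFour I * I_sq

lemma neg_inv_two_mul_I_sub_two : -(2 * I - 2)⁻¹ = (1 + I) / 2 / 2 := by
  apply Complex.ext <;> simp [Complex.inv_re, Complex.inv_im, Complex.normSq_apply] <;> norm_num

lemma neg_inv_two_mul_I_add_two : -(2 * I + 2)⁻¹ = (I - 1) / 4 := by
  apply Complex.ext <;> simp [Complex.inv_re, Complex.inv_im, Complex.normSq_apply] <;> norm_num

lemma apply_two_mul_I_sub_two {f : ℂ → ℂ} (hf : ∀ {z : ℂ}, 0 < z.im → f (z + 1) = f z) :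
    f (2 * I - 2) = f (2 * I) := by
  rw [← hf (z := 2 * I - 2) (by simp), ← hf (z := 2 * I - 2 + 1) (by simp)]
  congr 1
  ring

lemma apply_two_mul_I_add_two {f : ℂ → ℂ} (hf : ∀ {z : ℂ}, 0 < z.im → f (z + 1) = f z) :
    f (2 * I + 2) = f (2 * I) := by
  rw [← hf (z := 2 * I) (by simp), ← hf (z := 2 * I + 1) (by simp)]
  congr 1
  ring

lemma apply_one_add_I_div_two_add_one_div_two {f : ℂ → ℂ}
    (hf : ∀ {z : ℂ}, 0 < z.im → f (z + 1) = f z) :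
    f (((1 + I) / 2 + 1) / 2) = f ((I - 1) / 4) := by
  rw [← hf (z := (I - 1) / 4) (by simp)]
  congr 1
  ring

lemma eisensteinTwoLevelTwo_one_add_I_div_two : eisensteinTwoLevelTwo ((1 + I) / 2) =
    -2 * I * (2 * eisensteinTwo (2 * I) - eisensteinTwo I) := by
  have hπ : (π : ℂ) ≠ 0 := by simp
  have h := eisensteinTwo_neg_inv (z := 2 * I - 2) (by simp)
  rw [neg_inv_two_mul_I_sub_two, apply_two_mul_I_sub_two eisensteinTwo_add_one] at h
  rw [eisensteinTwoLevelTwo, eisensteinTwo_one_add_I_div_two, h, eisensteinTwo_I]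
  field_simp
  ring_nf
  simp only [I_sq, I_pow_three]
  ring

lemma eisensteinTwoLevelTwo_one_add_I_div_two_add_one : eisensteinTwoLevelTwo ((1 + I) / 2 + 1) =
    2 * I * (2 * eisensteinTwo (2 * I) - eisensteinTwo I) := by
  have hπ : (π : ℂ) ≠ 0 := by simp
  have h := eisensteinTwo_neg_inv (z := 2 * I + 2) (by simp)
  rw [neg_inv_two_mul_I_add_two, apply_two_mul_I_add_two eisensteinTwo_add_one] at h
  rw [eisensteinTwoLevelTwo, apply_one_add_I_div_two_add_one_div_two eisensteinTwo_add_one,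
    eisensteinTwo_add_one (by simp), eisensteinTwo_one_add_I_div_two, h, eisensteinTwo_I]
  field_simp
  ring_nf
  simp only [I_sq, I_pow_three]
  ring

lemma eisensteinFour_one_add_I_div_four_eq :
    eisensteinFour ((1 + I) / 2 / 2) = eisensteinFour (((1 + I) / 2 + 1) / 2) := by
  have h1 := eisensteinFour_neg_inv (z := 2 * I - 2) (by simp)
  have h2 := eisensteinFour_neg_inv (z := 2 * I + 2) (by simp)
  rw [neg_inv_two_mul_I_sub_two, apply_two_mul_I_sub_two eisensteinFour_add_one] at h1
  rw [neg_inv_two_mul_I_add_two, apply_two_mul_I_add_two eisensteinFour_add_one] at h2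
  rw [apply_one_add_I_div_two_add_one_div_two eisensteinFour_add_one, h1, h2]
  linear_combination -128 * I * eisensteinFour (2 * I) * I_sq

lemma deriv_deriv_eisensteinTwo_sub_eq :
    deriv (deriv eisensteinTwo) ((1 + I) / 2 / 2) -
        deriv (deriv eisensteinTwo) (((1 + I) / 2 + 1) / 2) =
      16 / 9 * π ^ 2 * I * (2 * eisensteinTwo (2 * I) - eisensteinTwo I) *
        (108 / π ^ 2 + 36 * eisensteinFour I -
          64 * (2 * eisensteinTwo (2 * I) - eisensteinTwo I) ^ 2) := by
  rw [deriv_deriv_eisensteinTwo_sub (by simp) (by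
      rw [eisensteinTwoLevelTwo_one_add_I_div_two, eisensteinTwoLevelTwo_one_add_I_div_two_add_one]
      ring), eisensteinTwoLevelTwo_one_add_I_div_two, eisensteinTwo_one_add_I_div_two,
    eisensteinFour_one_add_I_div_two]
  rw [mul_pow, mul_pow, I_sq]
  ring

lemma summable_prod_pow_mul_pow_mul_pow (k j : ℕ) {r : ℂ} (hr : ‖r‖ < 1) :
    Summable fun c : ℕ+ × ℕ+ ↦ (c.2 : ℂ) ^ k * ((c.1 * c.2 : ℕ) : ℂ) ^ j * r ^ (c.1 * c.2 : ℕ) := by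
  set s := √‖r‖ with hs
  have hs0 : 0 ≤ s := Real.sqrt_nonneg _
  have hs1 : s < 1 := by rw [hs, Real.sqrt_lt' one_pos]; simpa using hr
  have hss : ‖r‖ = s * s := (Real.mul_self_sqrt (norm_nonneg r)).symm
  obtain ⟨C, hC⟩ := ((tendsto_pow_const_mul_const_pow_of_lt_one j hs0 hs1).bddAbove_range)
  have h := (summable_prod_mul_pow (𝕜 := ℝ) k (r := s) (by rwa [Real.norm_of_nonneg hs0])).mul_left C
  refine Summable.of_norm_bounded h fun c ↦ ?_
  have hc := hC ⟨(c.1 * c.2 : ℕ), rfl⟩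
  simp only [norm_mul, norm_pow, hss, mul_pow, Complex.norm_natCast] at hc ⊢
  have h1 : 0 ≤ (c.2 : ℝ) ^ k * s ^ (c.1 * c.2 : ℕ) := by positivity
  calc _ = (((c.1 * c.2 : ℕ) : ℝ) ^ j * s ^ (c.1 * c.2 : ℕ)) * ((c.2 : ℝ) ^ k * s ^ (c.1 * c.2 : ℕ)) := by
        push_cast; ring
    _ ≤ _ := mul_le_mul_of_nonneg_right hc h1

/-- Rearrangement of a Lambert series. -/
lemma hasSum_prod_of_hasSum_sigma {k j : ℕ} {r a : ℂ} (hr : ‖r‖ < 1)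
    (h : HasSum (fun n : ℕ ↦ (ArithmeticFunction.sigma k n : ℂ) * (n : ℂ) ^ j * r ^ n) a) :
    HasSum (fun c : ℕ+ × ℕ+ ↦
      (c.2 : ℂ) ^ k * ((c.1 * c.2 : ℕ) : ℂ) ^ j * r ^ (c.1 * c.2 : ℕ)) a := by
  have hs := (summable_prod_pow_mul_pow_mul_pow k j hr).hasSum
  have h1 := sigmaAntidiagonalEquivProd.hasSum_iff.2 hs
  have h2 := h1.sigma (g := fun n : ℕ+ ↦
    (ArithmeticFunction.sigma k n : ℂ) * (n : ℂ) ^ j * r ^ (n : ℕ)) fun n ↦ by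
      have e (x : (n : ℕ).divisorsAntidiagonal) :
          ((x.1.2 : ℕ) : ℂ) ^ k * (n : ℂ) ^ j * r ^ (n : ℕ) =
            (fun c : ℕ+ × ℕ+ ↦ (c.2 : ℂ) ^ k * ((c.1 * c.2 : ℕ) : ℂ) ^ j * r ^ (c.1 * c.2 : ℕ))
              (sigmaAntidiagonalEquivProd ⟨n, x⟩) := by
        have hx : (x.1.1 * x.1.2 : ℕ) = n := (Nat.mem_divisorsAntidiagonal.1 x.2).1
        simp only [sigmaAntidiagonalEquivProd, divisorsAntidiagonalFactors, Equiv.coe_fn_mk,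
          PNat.mk_coe, hx]
      have h := (hasSum_fintype fun x : (n : ℕ).divisorsAntidiagonal ↦
        ((x.1.2 : ℕ) : ℂ) ^ k * (n : ℂ) ^ j * r ^ (n : ℕ)).congr_fun fun x ↦ (e x).symm
      convert! h using 1
      rw [← Finset.sum_mul, ← Finset.sum_mul,
        Finset.sum_coe_sort (n : ℕ).divisorsAntidiagonal fun x ↦ (x.2 : ℂ) ^ k,
        Nat.sum_divisorsAntidiagonal' fun _ y ↦ (y : ℂ) ^ k, ArithmeticFunction.sigma_apply]
      push_cast
      rfl
  have h3 := (PNat.coe_injective.hasSum_iff (f := fun n : ℕ ↦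
    (ArithmeticFunction.sigma k n : ℂ) * (n : ℂ) ^ j * r ^ n) (fun x hx ↦ by
      have : x = 0 := by
        by_contra h0
        exact hx ⟨⟨x, Nat.pos_of_ne_zero h0⟩, rfl⟩
      simp [this])).2 h
  rwa [h2.unique h3] at hs

lemma hasSum_mul_succ_mul_pow {y : ℂ} (hy : ‖y‖ < 1) :
    HasSum (fun k : ℕ ↦ (k * (k + 1) : ℂ) * y ^ k) (2 * y / (1 - y) ^ 3) := by
  rw [← hasSum_nat_add_iff' 1]
  have h := (hasSum_choose_mul_geometric_of_norm_lt_one 2 hy).mul_left (2 * y)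
  convert! h using 1
  · funext k
    rw [Nat.cast_choose_two]
    push_cast
    ring
  · simp
    ring

lemma I_pow_odd_mul_odd (k n : ℕ) (x : ℂ) : (I * x) ^ ((2 * k + 1) * (2 * n + 1)) -
    (-I * x) ^ ((2 * k + 1) * (2 * n + 1)) =
      2 * I * (-1) ^ n * (-1) ^ k * (x ^ (2 * n + 1)) ^ (2 * k + 1) := by
  have h : Odd ((2 * k + 1) * (2 * n + 1)) := Odd.mul ⟨k, rfl⟩ ⟨n, rfl⟩
  have h1 : I ^ ((2 * k + 1) * (2 * n + 1)) = (-1) ^ n * (-1) ^ k * I := by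
    rw [show (2 * k + 1) * (2 * n + 1) = 2 * n + 2 * k + 1 + 4 * (k * n) by ring, pow_add,
      pow_mul I 4, I_pow_four, one_pow, pow_succ, pow_add, pow_mul, pow_mul, I_sq, mul_one]
  rw [mul_pow, mul_pow, h.neg_pow, h1, ← pow_mul]
  ring

lemma hasSum_sech_cubed_of_hasSum_lambert {q : ℝ} {b : ℂ} (hq0 : 0 < q) (hq : q < 1)
    (h : HasSum (fun c : ℕ+ × ℕ+ ↦ (c.2 : ℂ) ^ 3 * (1 - (c.1 : ℂ) ^ 2) *
      ((I * q) ^ (c.1 * c.2 : ℕ) - (-I * q) ^ (c.1 * c.2 : ℕ))) b) :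
    HasSum (fun n : ℕ ↦ 2 * I * (-1) ^ n * (2 * n + 1) ^ 3 *
      (8 * ((q : ℂ) ^ (2 * n + 1)) ^ 3 / (1 + ((q : ℂ) ^ (2 * n + 1)) ^ 2) ^ 3)) b := by
  have hi : Function.Injective (fun p : ℕ × ℕ ↦
      ((⟨2 * p.2 + 1, Nat.succ_pos _⟩, ⟨2 * p.1 + 1, Nat.succ_pos _⟩) : ℕ+ × ℕ+)) := by
    rintro ⟨p, m⟩ ⟨p', m'⟩ h
    have h1 := congrArg (fun c ↦ (c.1 : ℕ)) h
    have h2 := congrArg (fun c ↦ (c.2 : ℕ)) h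
    simp at h1 h2
    simp [h1, h2]
  have h1 := (hi.hasSum_iff (fun c hc ↦ ?_)).2 h
  · refine h1.prod_fiberwise fun n ↦ ?_
    have hx : ‖-((q : ℂ) ^ (2 * n + 1)) ^ 2‖ < 1 := by
      rw [norm_neg, norm_pow, norm_pow, Complex.norm_real, Real.norm_of_nonneg hq0.le, ← pow_mul]
      exact pow_lt_one₀ hq0.le hq (by positivity)
    have h2 := (hasSum_mul_succ_mul_pow hx).mul_left
      (2 * I * (-1) ^ n * (2 * n + 1) ^ 3 * (-4 * (q : ℂ) ^ (2 * n + 1)))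
    convert! h2 using 1
    · funext k
      simp only [Function.comp_apply, PNat.mk_coe]
      rw [I_pow_odd_mul_odd, neg_pow, ← pow_mul]
      push_cast
      ring
    · ring
  · have h2 : Even (c.1 * c.2 : ℕ) := by
      by_contra hodd
      rw [Nat.not_even_iff_odd, Nat.odd_mul] at hodd
      obtain ⟨⟨k, hk⟩, ⟨n, hn⟩⟩ := hodd
      exact hc ⟨(n, k), Prod.ext (PNat.eq hk.symm) (PNat.eq hn.symm)⟩
    rw [neg_mul, h2.neg_pow, sub_self, mul_zero]

lemma cexp_one_add_I_div_four : cexp (2 * π * I * ((1 + I) / 2 / 2)) = I * rexp (-(π / 2)) := by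
  rw [show 2 * π * I * ((1 + I) / 2 / 2) = π / 2 * I + (-(π / 2) : ℝ) by
    push_cast; linear_combination π / 2 * I_sq, Complex.exp_add, Complex.exp_pi_div_two_mul_I,
    ofReal_exp]

lemma cexp_three_add_I_div_four :
    cexp (2 * π * I * (((1 + I) / 2 + 1) / 2)) = -I * rexp (-(π / 2)) := by
  rw [show 2 * π * I * (((1 + I) / 2 + 1) / 2) = 2 * π * I * ((1 + I) / 2 / 2) + π * I by ring,
    Complex.exp_add, Complex.exp_pi_mul_I, cexp_one_add_I_div_four]
  ring

lemma hasSum_deriv_deriv_eisensteinTwo {z : ℂ} (hz : 0 < z.im) :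
    HasSum (fun n : ℕ ↦ (ArithmeticFunction.sigma 1 n : ℂ) * (n : ℂ) ^ 2 * cexp (2 * π * I * z) ^ n)
      (deriv (deriv eisensteinTwo) z / (96 * π ^ 2)) := by
  have h := ((hasSum_deriv_of_hasSum_cexp
    (fun _ hw ↦ (hasSum_deriv_of_hasSum_cexp (fun _ ↦ hasSum_eisensteinTwo) hw).2) hz).2).div_const
      (96 * π ^ 2 : ℂ)
  have hπ : (π : ℂ) ≠ 0 := by simp
  refine h.congr_fun fun n ↦ ?_
  rw [← Complex.exp_nat_mul, show (n : ℂ) * (2 * π * I * z) = 2 * π * I * n * z by ring]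
  rcases eq_or_ne n 0 with rfl | hn
  · simp
  · rw [if_neg hn]
    field_simp
    linear_combination 96 * (ArithmeticFunction.sigma 1 n : ℂ) * I_sq

lemma hasSum_sigma_three {z : ℂ} (hz : 0 < z.im) :
    HasSum (fun n : ℕ ↦ (ArithmeticFunction.sigma 3 n : ℂ) * (n : ℂ) ^ 0 * cexp (2 * π * I * z) ^ n)
      ((eisensteinFour z - 1) / 240) := by
  refine (((hasSum_eisensteinFour hz).sub (hasSum_ite_eq 0 1)).div_const 240).congr_fun fun n ↦ ?_
  rw [← Complex.exp_nat_mul, show (n : ℂ) * (2 * π * I * z) = 2 * π * I * n * z by ring]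
  rcases eq_or_ne n 0 with rfl | hn
  · simp
  · rw [if_neg hn, if_neg hn]
    ring

lemma sum_odd_cube_cosh_cubed_eq_eisenstein :
    ((∑' n : ℕ, (-1 : ℝ) ^ n * (2 * (n : ℝ) + 1) ^ 3 /
        Real.cosh ((2 * (n : ℝ) + 1) * π / 2) ^ 3 : ℝ) : ℂ) =
      -(2 * eisensteinTwo (2 * I) - eisensteinTwo I) / 27 * (27 / π ^ 2 + 9 * eisensteinFour I -
          16 * (2 * eisensteinTwo (2 * I) - eisensteinTwo I) ^ 2) := by
  have hπ : (π : ℂ) ≠ 0 := by simp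
  have hq : rexp (-(π / 2)) < 1 := by simp [Real.pi_pos]
  have h0 : 0 < ((1 + I) / 2 / 2).im := by simp
  have h1 : 0 < (((1 + I) / 2 + 1) / 2).im := by simp
  have hn0 : ‖I * (rexp (-(π / 2)) : ℂ)‖ < 1 := by
    simpa [Complex.norm_real, -ofReal_exp] using hq
  have hn1 : ‖-I * (rexp (-(π / 2)) : ℂ)‖ < 1 := by
    simpa [Complex.norm_real, -ofReal_exp] using hq
  have a0 := hasSum_sigma_three h0
  have a1 := hasSum_sigma_three h1
  have b0 := hasSum_deriv_deriv_eisensteinTwo h0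
  have b1 := hasSum_deriv_deriv_eisensteinTwo h1
  rw [cexp_one_add_I_div_four] at a0 b0
  rw [cexp_three_add_I_div_four] at a1 b1
  have h := (((hasSum_prod_of_hasSum_sigma hn0 a0).sub (hasSum_prod_of_hasSum_sigma hn0 b0)).sub
    ((hasSum_prod_of_hasSum_sigma hn1 a1).sub (hasSum_prod_of_hasSum_sigma hn1 b1)))
  have h2 := (hasSum_sech_cubed_of_hasSum_lambert (Real.exp_pos _) hq
    (h.congr_fun fun c ↦ by push_cast; ring)).div_const (2 * I)
  rw [ofReal_tsum]
  have h3 : ((eisensteinFour ((1 + I) / 2 / 2) - 1) / 240 -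
      deriv (deriv eisensteinTwo) ((1 + I) / 2 / 2) / (96 * π ^ 2) -
      ((eisensteinFour (((1 + I) / 2 + 1) / 2) - 1) / 240 -
        deriv (deriv eisensteinTwo) (((1 + I) / 2 + 1) / 2) / (96 * π ^ 2))) / (2 * I) =
      -(2 * eisensteinTwo (2 * I) - eisensteinTwo I) / 27 * (27 / π ^ 2 + 9 * eisensteinFour I -
          16 * (2 * eisensteinTwo (2 * I) - eisensteinTwo I) ^ 2) := by
    rw [eisensteinFour_one_add_I_div_four_eq]
    have := deriv_deriv_eisensteinTwo_sub_eq
    field_simp at this ⊢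
    linear_combination -720 * this
  rw [← h3]
  refine HasSum.tsum_eq (h2.congr_fun fun n ↦ ?_)
  have hx : Real.cosh ((2 * (n : ℝ) + 1) * π / 2) =
      (rexp (-(π / 2)) ^ (2 * n + 1) + (rexp (-(π / 2)) ^ (2 * n + 1))⁻¹) / 2 := by
    rw [Real.cosh_eq, ← Real.exp_nat_mul, ← Real.exp_neg]
    push_cast
    rw [add_comm]
    congr 3 <;> ring
  rw [hx]
  generalize hy : rexp (-(π / 2)) ^ (2 * n + 1) = x
  have hx0 : 0 < x := hy ▸ by positivity
  rw [← ofReal_pow, hy]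
  have hx1 : (x : ℂ) ≠ 0 := by exact_mod_cast hx0.ne'
  have hx2 : (1 + (x : ℂ) ^ 2) ≠ 0 := by
    have : (1 + x ^ 2) ≠ 0 := by positivity
    exact_mod_cast this
  have hx3 : (x : ℂ) + (x : ℂ)⁻¹ ≠ 0 := by
    have : x + x⁻¹ ≠ 0 := by positivity
    exact_mod_cast this
  push_cast
  have : (x : ℂ) + (x : ℂ)⁻¹ = (1 + (x : ℂ) ^ 2) / x := by field_simp; ring
  rw [this]
  clear * - hx1 hx2
  field_simp
  ring

theorem le_of_weierstrass_equation {y p : ℝ → ℝ} {r : ℝ} (hr : 0 < r)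
    (hy : ∀ x ∈ Set.Ioo (0 : ℝ) 1, HasDerivAt y (p x) x)
    (hw : ∀ x ∈ Set.Ioo (0 : ℝ) 1, p x ^ 2 = 4 * y x * (y x ^ 2 - r ^ 2))
    (hlim : Tendsto y (𝓝[>] 0) (Bornology.cobounded ℝ)) :
    ∀ x ∈ Set.Ioo (0 : ℝ) 1, r ≤ y x := by
  intro x hx
  by_contra! hlt
  have hev : ∀ᶠ t in 𝓝[>] (0 : ℝ), 2 * r ≤ ‖y t‖ :=
    (tendsto_norm_atTop_iff_cobounded.mpr hlim).eventually_ge_atTop _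
  obtain ⟨t, ht, htm⟩ := (hev.and (Ioo_mem_nhdsGT one_pos)).exists
  have hcont : ContinuousOn y (Set.Ioo 0 1) := fun z hz ↦ (hy z hz).continuousAt.continuousWithinAt
  have key : ∀ z ∈ Set.Ioo (0 : ℝ) 1, 0 ≤ y z * (y z ^ 2 - r ^ 2) := fun z hz ↦ by
    nlinarith [hw z hz, sq_nonneg (p z)]
  have hyt : r ≤ y t := by
    by_contra! h
    have h1 := key t htm
    rw [Real.norm_eq_abs] at ht
    rcases abs_cases (y t) with ⟨h2, h3⟩ | ⟨h2, h3⟩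
    · linarith
    · have : 0 < y t ^ 2 - r ^ 2 := by nlinarith
      nlinarith
  have hyx : y x ≤ r / 2 := by
    by_contra! h
    have h1 := key x hx
    have : y x ^ 2 - r ^ 2 < 0 := by nlinarith
    nlinarith
  obtain ⟨z, hz, hyz⟩ := (isPreconnected_Ioo (a := (0 : ℝ)) (b := 1)).intermediate_value hx htm hcont
    (show r / 2 ∈ Set.Icc (y x) (y t) from ⟨hyx, by linarith⟩)
  have h1 := key z hz
  rw [hyz] at h1
  nlinarith [pow_pos hr 3]

theorem integral_eq_of_weierstrass_equation {y p : ℝ → ℝ} {r : ℝ} (hr : 0 < r)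
    (hy : ∀ x ∈ Set.Ioo (0 : ℝ) 1, HasDerivAt y (p x) x)
    (hp : ∀ x ∈ Set.Ioo (0 : ℝ) 1, HasDerivAt p (6 * y x ^ 2 - 2 * r ^ 2) x)
    (hw : ∀ x ∈ Set.Ioo (0 : ℝ) 1, p x ^ 2 = 4 * y x * (y x ^ 2 - r ^ 2))
    (h0 : p (1 / 2) = 0)
    (hlim : Tendsto y (𝓝[>] 0) (Bornology.cobounded ℝ)) :
    y (1 / 2) = r ∧ ∫ u in Set.Ioo (0 : ℝ) 1, u ^ (-(3 / 4) : ℝ) * (1 - u) ^ (-(1 / 2) : ℝ) =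
      2 * √r := by
  have hle := le_of_weierstrass_equation hr hy hw hlim
  have hhalf : (1 / 2 : ℝ) ∈ Set.Ioo (0 : ℝ) 1 := by constructor <;> norm_num
  have hyhalf : y (1 / 2) = r := by
    have h1 := hw _ hhalf
    have h2 := hle _ hhalf
    rw [h0] at h1
    have h3 : y (1 / 2) * (y (1 / 2) + r) * (y (1 / 2) - r) = 0 := by linarith
    have h4 : 0 < y (1 / 2) * (y (1 / 2) + r) := by
      have := hr.trans_le h2
      positivity
    linarith [(mul_eq_zero.mp h3).resolve_left h4.ne']
  refine ⟨hyhalf, ?_⟩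
  have hpmono : StrictMonoOn p (Set.Ioo 0 1) := by
    refine strictMonoOn_of_deriv_pos (convex_Ioo 0 1)
      (fun z hz ↦ (hp z hz).continuousAt.continuousWithinAt) fun z hz ↦ ?_
    rw [interior_Ioo] at hz
    rw [(hp z hz).deriv]
    nlinarith [hle z hz]
  have hsub : Set.Ioo (0 : ℝ) (1 / 2) ⊆ Set.Ioo 0 1 :=
    Set.Ioo_subset_Ioo_right (by norm_num)
  have hpneg : ∀ x ∈ Set.Ioo (0 : ℝ) (1 / 2), p x < 0 := fun x hx ↦ by
    rw [← h0]
    exact hpmono (hsub hx) hhalf hx.2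
  set u : ℝ → ℝ := fun x ↦ if x ≤ 0 then 0 else r ^ 2 / y x ^ 2 with hu
  have hu0 : u 0 = 0 := by simp [hu]
  have hupos : ∀ x, 0 < x → u x = r ^ 2 / y x ^ 2 := fun x hx ↦ by simp [hu, hx.not_ge]
  have hu1 : u (1 / 2) = 1 := by
    rw [hupos _ (by norm_num), hyhalf, div_self (by positivity)]
  have hderiv : ∀ x ∈ Set.Ioo (0 : ℝ) 1, HasDerivAt u (-(2 * r ^ 2 * p x / y x ^ 3)) x := by
    intro x hx
    have hypos : y x ≠ 0 := (hr.trans_le (hle x hx)).ne'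
    have h1 : HasDerivAt (fun x ↦ r ^ 2 / y x ^ 2) (-(2 * r ^ 2 * p x / y x ^ 3)) x := by
      refine ((hasDerivAt_const x (r ^ 2)).div ((hy x hx).fun_pow 2)
        (pow_ne_zero 2 hypos)).congr_deriv ?_
      field_simp
      push_cast
      ring
    refine h1.congr_of_eventuallyEq ?_
    filter_upwards [lt_mem_nhds hx.1] with t ht
    exact hupos t ht
  have hcont : ContinuousOn u (Set.Icc 0 (1 / 2)) := by
    intro x hx
    rcases hx.1.eq_or_lt with rfl | hx0
    · have h1 : Tendsto (fun x ↦ r ^ 2 / y x ^ 2) (𝓝[>] 0) (𝓝 0) := by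
        refine Tendsto.div_atTop tendsto_const_nhds ?_
        have := (tendsto_norm_atTop_iff_cobounded.mpr hlim)
        refine ((tendsto_pow_atTop two_ne_zero).comp this).congr fun t ↦ ?_
        simp
      have h2 : ContinuousWithinAt u (Set.Ioi 0) 0 := by
        rw [ContinuousWithinAt, hu0]
        refine h1.congr' ?_
        filter_upwards [self_mem_nhdsWithin] with t ht
        exact (hupos t ht).symm
      exact (continuousWithinAt_Ioi_iff_Ici.mp h2).mono Set.Icc_subset_Ici_self
    · exact (hderiv x ⟨hx0, by linarith [hx.2]⟩).continuousAt.continuousWithinAt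
  have hmono : StrictMonoOn u (Set.Icc 0 (1 / 2)) := by
    refine strictMonoOn_of_deriv_pos (convex_Icc _ _) hcont fun x hx ↦ ?_
    rw [interior_Icc] at hx
    rw [(hderiv x (hsub hx)).deriv]
    have h1 := hpneg x hx
    have h2 : 0 < y x := hr.trans_le (hle x (hsub hx))
    have h3 : 0 < 2 * r ^ 2 * (-p x) / y x ^ 3 := by
      have : 0 < -p x := by linarith
      positivity
    linarith [show 2 * r ^ 2 * (-p x) / y x ^ 3 = -(2 * r ^ 2 * p x / y x ^ 3) by ring]
  have himage : u '' Set.Ioo 0 (1 / 2) = Set.Ioo 0 1 := by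
    rw [hcont.image_Ioo_of_strictMonoOn (by norm_num) hmono, hu0, hu1]
  rw [← himage, MeasureTheory.integral_image_eq_integral_abs_deriv_smul measurableSet_Ioo
    (fun x hx ↦ (hderiv x (hsub hx)).hasDerivWithinAt)
    (hmono.injOn.mono Set.Ioo_subset_Icc_self)]
  have hint : ∀ x ∈ Set.Ioo (0 : ℝ) (1 / 2), |-(2 * r ^ 2 * p x / y x ^ 3)| •
      (u x ^ (-(3 / 4) : ℝ) * (1 - u x) ^ (-(1 / 2) : ℝ)) = 4 * √r := by
    intro x hx
    have h1 : 0 < -p x := by linarith [hpneg x hx]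
    have h2 : 0 < y x := hr.trans_le (hle x (hsub hx))
    obtain ⟨s, hs, hys⟩ : ∃ s, 0 < s ∧ y x = s ^ 2 :=
      ⟨√(y x), Real.sqrt_pos.mpr h2, (Real.sq_sqrt h2.le).symm⟩
    obtain ⟨t, ht, hrt⟩ : ∃ t, 0 < t ∧ r = t ^ 2 :=
      ⟨√r, Real.sqrt_pos.mpr hr, (Real.sq_sqrt hr.le).symm⟩
    have h3 : u x = (t / s) ^ 4 := by
      rw [hupos x hx.1, hys, hrt]
      field_simp
    have h4 : 1 - u x = (-p x / (2 * s ^ 3)) ^ 2 := by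
      rw [h3, div_pow (-p x), neg_sq, hw x (hsub hx), hys, hrt]
      field_simp
      ring
    have h5 : (u x) ^ (-(3 / 4) : ℝ) = (s / t) ^ 3 := by
      rw [h3, ← Real.rpow_natCast, ← Real.rpow_mul (by positivity),
        show ((4 : ℕ) : ℝ) * -(3 / 4) = -((3 : ℕ) : ℝ) by norm_num, Real.rpow_neg (by positivity),
        Real.rpow_natCast, ← inv_pow, inv_div]
    have h6 : (1 - u x) ^ (-(1 / 2) : ℝ) = 2 * s ^ 3 / -p x := by
      rw [h4, ← Real.rpow_natCast, ← Real.rpow_mul (by positivity),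
        show ((2 : ℕ) : ℝ) * -(1 / 2) = -1 by norm_num, Real.rpow_neg_one, inv_div]
    have h7 : |-(2 * r ^ 2 * p x / y x ^ 3)| = 2 * r ^ 2 * (-p x) / y x ^ 3 := by
      rw [← abs_of_pos (show 0 < 2 * r ^ 2 * (-p x) / y x ^ 3 by positivity)]
      congr 1
      ring
    rw [h5, h6, h7, smul_eq_mul, hys, hrt, Real.sqrt_sq ht.le]
    have : p x ≠ 0 := by linarith
    field_simp
    ring
  rw [MeasureTheory.setIntegral_congr_fun measurableSet_Ioo hint, MeasureTheory.setIntegral_const]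
  simp
  ring

theorem integral_rpow_mul_one_sub_rpow :
    ∫ u in Set.Ioo (0 : ℝ) 1, u ^ (-(3 / 4) : ℝ) * (1 - u) ^ (-(1 / 2) : ℝ) =
      Real.Gamma (1 / 4) ^ 2 / √(2 * π) := by
  have h1 := ProbabilityTheory.beta_eq_betaIntegralReal (1 / 4) (1 / 2) (by norm_num) (by norm_num)
  have h2 : ProbabilityTheory.beta (1 / 4) (1 / 2) = Real.Gamma (1 / 4) ^ 2 / √(2 * π) := by
    have h3 := Real.Gamma_mul_Gamma_one_sub (1 / 4)
    rw [show (1 - 1 / 4 : ℝ) = 3 / 4 by norm_num, show π * (1 / 4) = π / 4 by ring,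
      Real.sin_pi_div_four] at h3
    have h4 : 0 < Real.Gamma (3 / 4) := Real.Gamma_pos_of_pos (by norm_num)
    have h5 : 0 < Real.Gamma (1 / 4) := Real.Gamma_pos_of_pos (by norm_num)
    rw [ProbabilityTheory.beta, Real.Gamma_one_half_eq, show (1 / 4 + 1 / 2 : ℝ) = 3 / 4 by norm_num,
      Real.sqrt_mul (by norm_num), div_eq_div_iff h4.ne' (by positivity)]
    have h6 : Real.Gamma (1 / 4) * Real.Gamma (3 / 4) * √2 = 2 * π := by
      rw [h3]
      field_simp
    have h7 : √π * √π = π := Real.mul_self_sqrt pi_pos.le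
    have h8 : √2 * √2 = 2 := Real.mul_self_sqrt (by norm_num)
    have h9 : Real.Gamma (1 / 4) * Real.Gamma (3 / 4) = √2 * π := by
      have : (0 : ℝ) < √2 := by positivity
      apply mul_right_cancel₀ this.ne'
      rw [h6]
      linear_combination (-π) * h8
    linear_combination Real.Gamma (1 / 4) * √2 * h7 - Real.Gamma (1 / 4) * h9
  rw [← h2, h1, Complex.betaIntegral, intervalIntegral.integral_of_le zero_le_one,
    MeasureTheory.integral_Ioc_eq_integral_Ioo,
    MeasureTheory.setIntegral_congr_fun measurableSet_Ioo
      (g := fun u : ℝ ↦ ((u ^ (-(3 / 4) : ℝ) * (1 - u) ^ (-(1 / 2) : ℝ) : ℝ) : ℂ)) fun u hu ↦ ?_]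
  · rw [integral_complex_ofReal, ofReal_re]
  · have h3 : (0 : ℝ) ≤ 1 - u := by linarith [hu.2]
    simp only [ofReal_mul, ofReal_cpow hu.1.le, ofReal_cpow h3]
    push_cast
    norm_num

theorem eq_Gamma_of_weierstrass_equation {y p : ℝ → ℝ} {g : ℝ} (hg : 0 < g)
    (hy : ∀ x ∈ Set.Ioo (0 : ℝ) 1, HasDerivAt y (p x) x)
    (hp : ∀ x ∈ Set.Ioo (0 : ℝ) 1, HasDerivAt p (6 * y x ^ 2 - g / 2) x)
    (hw : ∀ x ∈ Set.Ioo (0 : ℝ) 1, p x ^ 2 = 4 * y x ^ 3 - g * y x)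
    (h0 : p (1 / 2) = 0)
    (hlim : Tendsto y (𝓝[>] 0) (Bornology.cobounded ℝ)) :
    y (1 / 2) = Real.Gamma (1 / 4) ^ 4 / (8 * π) ∧ g = 4 * y (1 / 2) ^ 2 := by
  obtain ⟨r, hr, rfl⟩ : ∃ r, 0 < r ∧ g = 4 * r ^ 2 :=
    ⟨√g / 2, by positivity, by rw [div_pow, Real.sq_sqrt hg.le]; ring⟩
  obtain ⟨h1, h2⟩ := integral_eq_of_weierstrass_equation hr hy
    (fun x hx ↦ (hp x hx).congr_deriv (by ring)) (fun x hx ↦ (hw x hx).trans (by ring)) h0 hlim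
  rw [integral_rpow_mul_one_sub_rpow] at h2
  rw [h1]
  refine ⟨?_, rfl⟩
  have h3 : (Real.Gamma (1 / 4) ^ 2 / √(2 * π)) ^ 2 = 4 * r := by
    rw [h2, mul_pow, Real.sq_sqrt hr.le]
    norm_num
  rw [div_pow, Real.sq_sqrt (by positivity)] at h3
  have : π ≠ 0 := pi_ne_zero
  field_simp at h3 ⊢
  linarith

/-- The lattice of Gaussian integers. -/
noncomputable abbrev gaussianPeriodPair : PeriodPair := upperPeriodPair I (by simp)

lemma G_six_gaussianPeriodPair : gaussianPeriodPair.G 6 = 0 := by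
  have h : HasSum (fun l : gaussianPeriodPair.lattice ↦ ((l : ℂ) ^ 6)⁻¹)
      (gaussianPeriodPair.G 6) := by
    have := gaussianPeriodPair.hasSum_sumInvPow 0 (r := 6) (by norm_num)
    rw [PeriodPair.sumInvPow_zero] at this
    simpa using this
  replace h := (hasSum_lattice_iff (z := I) (by simp) (f := fun l ↦ (l ^ 6)⁻¹)).mp h
  have h2 := ((Equiv.prodComm ℤ ℤ).trans
    (Equiv.prodCongr (Equiv.refl ℤ) (Equiv.neg ℤ))).hasSum_iff.mpr h
  have h3 := h2.congr_fun (g := fun p : ℤ × ℤ ↦ -((p.1 * I + p.2) ^ 6)⁻¹) fun p ↦ by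
    simp only [Function.comp_apply, Equiv.trans_apply, Equiv.prodComm_apply, Prod.swap,
      Equiv.prodCongr_apply, Prod.map, Equiv.refl_apply, Equiv.neg_apply]
    rw [← inv_neg]
    congr 1
    have : (p.2 * I + ((-p.1 : ℤ) : ℂ)) = I * (p.1 * I + p.2) := by
      push_cast
      linear_combination (-p.1 : ℂ) * I_sq
    rw [this, mul_pow, show (I : ℂ) ^ 6 = -1 by linear_combination (I ^ 4 - I ^ 2 + 1) * I_sq]
    ring
  exact self_eq_neg.mp (h3.unique h.neg)

lemma conj_eq_of_hasSum {f : ℂ → ℂ} {a : ℂ} (hf : ∀ z, f (conj z) = conj (f z))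
    (h : HasSum (fun l : gaussianPeriodPair.lattice ↦ f l) a) : conj a = a := by
  replace h := (hasSum_lattice_iff (z := I) (by simp) (f := f)).mp h
  have h2 := ((Equiv.neg ℤ).prodCongr (Equiv.refl ℤ)).hasSum_iff.mpr h
  refine (h.map (starRingEnd ℂ) continuous_conj).unique (h2.congr_fun fun p ↦ ?_)
  simp [← hf]

lemma conj_weierstrassP_ofReal (x : ℝ) :
    conj (℘[gaussianPeriodPair] x) = ℘[gaussianPeriodPair] x :=
  conj_eq_of_hasSum (f := fun l ↦ 1 / (x - l) ^ 2 - 1 / l ^ 2) (by simp)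
    (gaussianPeriodPair.hasSum_weierstrassP x)

lemma conj_derivWeierstrassP_ofReal (x : ℝ) :
    conj (℘'[gaussianPeriodPair] x) = ℘'[gaussianPeriodPair] x :=
  conj_eq_of_hasSum (f := fun l ↦ -2 / (x - l) ^ 3) (by simp [conj_ofNat])
    (gaussianPeriodPair.hasSum_derivWeierstrassP x)

lemma ofReal_notMem_gaussianPeriodPair {x : ℝ} (hx : x ∈ Set.Ioo (0 : ℝ) 1) :
    (x : ℂ) ∉ gaussianPeriodPair.lattice := by
  rw [PeriodPair.mem_lattice]
  rintro ⟨m, n, h⟩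
  have h1 := congrArg Complex.re h
  simp [gaussianPeriodPair, upperPeriodPair] at h1
  rw [← h1] at hx
  have h2 : 0 < n := by exact_mod_cast hx.1
  have h3 : n < 1 := by exact_mod_cast hx.2
  lia

lemma derivWeierstrassP_one_div_two : ℘'[gaussianPeriodPair] (1 / 2) = 0 := by
  have h := gaussianPeriodPair.derivWeierstrassP_add_coe (-1 / 2)
    ⟨_, gaussianPeriodPair.ω₂_mem_lattice⟩
  have h2 := gaussianPeriodPair.derivWeierstrassP_neg (1 / 2)
  simp only [gaussianPeriodPair, upperPeriodPair] at h h2 ⊢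
  rw [show (-1 / 2 + 1 : ℂ) = 1 / 2 by norm_num, show (-1 / 2 : ℂ) = -(1 / 2) by norm_num, h2] at h
  linear_combination h / 2

lemma eisensteinFour_I : ∃ Q : ℝ, 0 < Q ∧ eisensteinFour I = Q := by
  have h := hasSum_eisensteinFour (z := I) (by simp)
  have h2 : ∀ n : ℕ, (if n = 0 then 1 else 240 * ArithmeticFunction.sigma 3 n : ℂ) *
      cexp (2 * π * I * n * I) = (((if n = 0 then 1 else 240 * ArithmeticFunction.sigma 3 n : ℝ) *
      rexp (-2 * π * n) : ℝ) : ℂ) := fun n ↦ by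
    rw [show 2 * π * I * n * I = ((-2 * π * n : ℝ) : ℂ) by
      push_cast
      linear_combination 2 * π * n * I_sq]
    split_ifs <;> push_cast <;> ring
  simp only [h2] at h
  have h3 := hasSum_re h
  refine ⟨(eisensteinFour I).re, ?_, ?_⟩
  · have h4 : ∀ n : ℕ, (0 : ℝ) ≤ ((if n = 0 then 1 else 240 * ArithmeticFunction.sigma 3 n : ℝ) *
        rexp (-2 * π * n)) := fun n ↦ by
      split_ifs <;> positivity
    have h5 := le_hasSum h3 0 fun n _ ↦ by simpa only [ofReal_re] using h4 n
    simp at h5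
    linarith
  · have h4 := hasSum_ofReal.mpr h3
    simp only [ofReal_re] at h4
    exact h.unique h4

theorem eisenstein_values : 2 * eisensteinTwo (2 * I) - eisensteinTwo I =
      (3 * Real.Gamma (1 / 4) ^ 4 / (16 * π ^ 3) : ℝ) ∧
    3 * eisensteinFour I = 4 * (2 * eisensteinTwo (2 * I) - eisensteinTwo I) ^ 2 := by
  obtain ⟨Q, hQ, hQI⟩ := eisensteinFour_I
  have hP : ∀ x : ℝ, (((℘[gaussianPeriodPair] x).re : ℝ) : ℂ) = ℘[gaussianPeriodPair] x :=
    fun x ↦ conj_eq_iff_re.mp (conj_weierstrassP_ofReal x)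
  have hP' : ∀ x : ℝ, (((℘'[gaussianPeriodPair] x).re : ℝ) : ℂ) = ℘'[gaussianPeriodPair] x :=
    fun x ↦ conj_eq_iff_re.mp (conj_derivWeierstrassP_ofReal x)
  have hg₂ : gaussianPeriodPair.g₂ = ((4 * π ^ 4 / 3 * Q : ℝ) : ℂ) := by
    rw [PeriodPair.g₂, G_four_upperPeriodPair (by simp), hQI]
    push_cast
    ring
  have hg₃ : gaussianPeriodPair.g₃ = 0 := by
    rw [PeriodPair.g₃, G_six_gaussianPeriodPair, mul_zero]
  obtain ⟨h1, h2⟩ := eq_Gamma_of_weierstrass_equation (y := fun x ↦ (℘[gaussianPeriodPair] x).re)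
    (p := fun x ↦ (℘'[gaussianPeriodPair] x).re) (g := 4 * π ^ 4 / 3 * Q) (by positivity)
    (fun x hx ↦ by
      have hx' := ofReal_notMem_gaussianPeriodPair hx
      have := (gaussianPeriodPair.analyticOnNhd_weierstrassP x hx').differentiableAt.hasDerivAt
      rw [PeriodPair.deriv_weierstrassP] at this
      exact this.real_of_complex)
    (fun x hx ↦ by
      have hx' := ofReal_notMem_gaussianPeriodPair hx
      have := (gaussianPeriodPair.analyticOnNhd_derivWeierstrassP x hx').differentiableAt.hasDerivAt
      rw [PeriodPair.deriv_derivWeierstrassP _ hx', hg₂, ← hP] at this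
      refine this.real_of_complex.congr_deriv ?_
      rw [← ofReal_re (6 * _ ^ 2 - _)]
      congr 1
      push_cast
      rfl)
    (fun x hx ↦ by
      have hx' := ofReal_notMem_gaussianPeriodPair hx
      have := gaussianPeriodPair.derivWeierstrassP_sq x hx'
      rw [hg₂, hg₃, ← hP, ← hP'] at this
      rw [sub_zero] at this
      exact_mod_cast this)
    (by
      have := derivWeierstrassP_one_div_two
      push_cast
      rw [this, zero_re])
    (by
      have h3 : Tendsto (fun x : ℝ ↦ (x : ℂ)) (𝓝[>] 0) (𝓝[≠] 0) := by
        refine tendsto_nhdsWithin_iff.mpr ⟨?_, ?_⟩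
        · exact (continuous_ofReal.tendsto' 0 0 (by simp)).mono_left nhdsWithin_le_nhds
        · filter_upwards [self_mem_nhdsWithin] with x hx
          simpa using (ne_of_gt hx : x ≠ 0)
      have h4 := (tendsto_norm_atTop_iff_cobounded.mpr
        (PeriodPair.tendsto_weierstrassP_cobounded gaussianPeriodPair)).comp h3
      refine tendsto_norm_atTop_iff_cobounded.mp (h4.congr fun x ↦ ?_)
      rw [Function.comp_apply, ← hP, norm_real, ofReal_re])
  have h3 := weierstrassP_one_div_two (z := I) (by simp)
  have h4 := hP (1 / 2)
  rw [h1] at h4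
  push_cast at h4
  rw [h3] at h4
  have hπ : (π : ℂ) ≠ 0 := ofReal_ne_zero.mpr pi_ne_zero
  have h5 : 2 * eisensteinTwo (2 * I) - eisensteinTwo I =
      (3 * Real.Gamma (1 / 4) ^ 4 / (16 * π ^ 3) : ℝ) := by
    push_cast
    field_simp at h4 ⊢
    linear_combination -h4
  refine ⟨h5, ?_⟩
  rw [h1] at h2
  have h6 : 3 * Q = 4 * (3 * Real.Gamma (1 / 4) ^ 4 / (16 * π ^ 3)) ^ 2 := by
    have := pi_ne_zero
    field_simp at h2 ⊢
    linear_combination 4 * h2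
  rw [h5, hQI]
  exact_mod_cast h6

end

theorem sum_odd_cube_cosh_cubed :
    (∑' n : ℕ, (-1 : ℝ) ^ n * (2*(n:ℝ)+1) ^ 3 / Real.cosh ((2*(n:ℝ)+1) * π / 2) ^ 3) =
      -(3 * Real.Gamma (1/4) ^ 4 / (2 ^ 4 * π ^ 5))
    + Real.Gamma (1/4) ^ 12 / (2 ^ 10 * π ^ 9) := by
  have h := sum_odd_cube_cosh_cubed_eq_eisenstein
  obtain ⟨h1, h2⟩ := eisenstein_values
  rw [show 9 * eisensteinFour Complex.I = 3 * (3 * eisensteinFour Complex.I) by ring, h2, h1] at h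
  rw [show (∑' n : ℕ, (-1 : ℝ) ^ n * (2 * (n : ℝ) + 1) ^ 3 /
      Real.cosh ((2 * (n : ℝ) + 1) * π / 2) ^ 3) = _ from by exact_mod_cast h]
  have := pi_ne_zero
  field_simp
  ring
end
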